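/- arXiv:1509.07098 — 2 statements merged into one kernel-verified Lean document; each statement's English description precedes it below -/
import Mathlib

section
/- Let K be a quadratic field and let c ∈ K. The map f_c admits a point α ∈ K of exact period 3 if and only if there exists t ∈ K with t(t+1)(t²+t+1) ≠ 0 such that α = (t³+2t²+t+1)/(2t(t+1)) and c = −(t⁶+2t⁵+4t⁴+8t³+9t²+4t+1)/(4t²(t+1)²). Moreover, in this case the set of all points of K of exact period 3 under f_c is precisely the three-element set {(t³+2t²+t+1)/(2t(t+1)), (t³−t−1)/(2t(t+1)), −(t³+2t²+3t+1)/(2t(t+1))}, and these three points form a single 3-cycle under f_c. -/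
/-- The quadratic map `z ↦ z ^ 2 + c`. -/
def fc {K : Type*} [Field K] (c : K) : K → K := fun z => z ^ 2 + c

/-- `α` has exact period `m` under `fc c`. -/
def HasExactPeriod {K : Type*} [Field K] (c : K) (m : ℕ) (α : K) : Prop :=
  (fc c)^[m] α = α ∧ ∀ j : ℕ, 1 ≤ j → j < m → (fc c)^[j] α ≠ α

/-- `α` has preperiodic type `m_n` under `fc c`: preperiod exactly `n`, eventual period `m`. -/
def HasPreperiodicType {K : Type*} [Field K] (c : K) (m n : ℕ) (α : K) : Prop :=
  HasExactPeriod c m ((fc c)^[n] α) ∧ (fc c)^[n + m - 1] α ≠ (fc c)^[n - 1] α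

theorem exists_fourth_powers_of_mul_eq {A B x : ℤ} {p j : ℕ} (hp : p.Prime) (hA : 0 < A)
    (hB : 0 < B) (hx : 0 < x) (hAB : IsCoprime A B) (h : A * B = (p : ℤ) ^ j * x ^ 4) :
    ∃ m n : ℤ, 0 < m ∧ 0 < n ∧ m * n = x ∧ IsCoprime m n ∧
      ((A = m ^ 4 ∧ B = (p : ℤ) ^ j * n ^ 4) ∨ (B = m ^ 4 ∧ A = (p : ℤ) ^ j * n ^ 4)) := by
  wlog hpA : ¬ (p : ℤ) ∣ A generalizing A B
  · have hpB : ¬ (p : ℤ) ∣ B := fun hpB =>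
      (Nat.prime_iff_prime_int.mp hp).not_isUnit (hAB.isUnit_of_dvd' (not_not.mp hpA) hpB)
    obtain ⟨m, n, hm, hn, hmn, hc, h'⟩ := this hB hA hAB.symm (by rw [mul_comm, h]) hpB
    exact ⟨m, n, hm, hn, hmn, hc, h'.symm⟩
  have hp' : Prime (p : ℤ) := Nat.prime_iff_prime_int.mp hp
  have hp0 : (0 : ℤ) < (p : ℤ) ^ j := pow_pos (by exact_mod_cast hp.pos) _
  obtain ⟨C, rfl⟩ : (p : ℤ) ^ j ∣ B :=
    (((Prime.coprime_iff_not_dvd hp').mpr hpA).pow_left).dvd_of_dvd_mul_left ⟨x ^ 4, h⟩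
  have hC : 0 < C := pos_of_mul_pos_right hB hp0.le
  have hAC : IsCoprime A C := hAB.of_mul_right_right
  have hprod : A * C = x ^ 4 := by
    apply mul_left_cancel₀ hp0.ne'
    linear_combination h
  have key : ∀ {a b : ℤ}, 0 < a → IsCoprime a b → a * b = x ^ 4 → ∃ m : ℤ, 0 < m ∧ a = m ^ 4 := by
    intro a b ha hab hm
    obtain ⟨d, hd⟩ := exists_associated_pow_of_mul_eq_pow' hab hm
    rw [Int.associated_iff] at hd
    have hd4 : a = d ^ 4 := by
      rcases hd with hd | hd
      · exact hd.symm
      · nlinarith [sq_nonneg (d ^ 2)]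
    have hd0 : d ≠ 0 := by rintro rfl; simp at hd4; omega
    exact ⟨|d|, abs_pos.mpr hd0, by rw [hd4, Even.pow_abs (by decide)]⟩
  obtain ⟨m, hm, rfl⟩ := key hA hAC hprod
  obtain ⟨n, hn, rfl⟩ := key hC hAC.symm (by rw [mul_comm, hprod])
  refine ⟨m, n, hm, hn, ?_, (IsCoprime.pow_iff (by norm_num) (by norm_num)).mp hAC, .inl ⟨rfl, rfl⟩⟩
  rw [← mul_pow] at hprod
  exact (pow_left_inj₀ (by positivity) hx.le (by norm_num)).mp hprod

theorem prime_dvd_of_mul_eq_prime_mul_pow {A B x p q : ℤ} (hp : Prime p) (hq : Prime q)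
    (h : A * B = q * x ^ 4) (hA : p ∣ A) (hB : p ∣ B) : p ∣ x := by
  by_contra hx
  have h1 : p * p ∣ q * x ^ 4 := h ▸ mul_dvd_mul hA hB
  have h2 : IsCoprime (p * p) (x ^ 4) := by
    have := (Prime.coprime_iff_not_dvd hp).mpr hx
    exact (this.mul_left this).pow_right
  exact hp.not_isUnit (hq.irreducible.squarefree p (h2.dvd_of_dvd_mul_right h1))

theorem pos_of_mul_pos_of_add_pos {A B : ℤ} (h : 0 < A * B) (h' : 0 < A + B) : 0 < A ∧ 0 < B := by
  rcases mul_pos_iff.mp h with h | h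
  · exact h
  · omega

theorem quartic_odd_step {x y z : ℤ} (hx : 0 < x) (hy : 0 < y) (hz : 0 ≤ z) (hxy : IsCoprime x y)
    (hxo : Odd x) (hyo : Odd y) (h : 8 * x ^ 4 - 11 * x ^ 2 * y ^ 2 + 4 * y ^ 4 = z ^ 2) :
    ∃ m f g : ℤ, 0 < m ∧ 0 < f ∧ 0 < g ∧ IsCoprime g f ∧ Odd f ∧ Odd g ∧ x = m * (f * g) ∧
      8 * g ^ 4 - 11 * g ^ 2 * f ^ 2 + 4 * f ^ 4 = m ^ 2 ∧
      (m ^ 2 + 11 * (f * g) ^ 2) ^ 2 - 128 * (f * g) ^ 4 = 16 * y ^ 2 := by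
  have hprod : (4 * z - 8 * y ^ 2 + 11 * x ^ 2) * (4 * z + 8 * y ^ 2 - 11 * x ^ 2)
      = ((7 : ℕ) : ℤ) ^ 1 * x ^ 4 := by push_cast; linear_combination -16 * h
  have hz0 : z ≠ 0 := by
    rintro rfl
    nlinarith [sq_nonneg (8 * y ^ 2 - 11 * x ^ 2), pow_pos hx 4]
  have hpos := pos_of_mul_pos_of_add_pos (A := 4 * z - 8 * y ^ 2 + 11 * x ^ 2)
    (B := 4 * z + 8 * y ^ 2 - 11 * x ^ 2) (by rw [hprod]; positivity)
    (by linarith [lt_of_le_of_ne hz hz0.symm])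
  have hcop : IsCoprime (4 * z - 8 * y ^ 2 + 11 * x ^ 2) (4 * z + 8 * y ^ 2 - 11 * x ^ 2) := by
    refine isCoprime_of_prime_dvd (by omega) fun p hp hA hB => ?_
    have hpx := prime_dvd_of_mul_eq_prime_mul_pow hp (q := 7) (by norm_num)
      (by simpa using hprod) hA hB
    have h16 : p ∣ 2 ^ 4 * y ^ 2 := by
      have e : 2 ^ 4 * y ^ 2 = (4 * z + 8 * y ^ 2 - 11 * x ^ 2) -
          (4 * z - 8 * y ^ 2 + 11 * x ^ 2) + 22 * x ^ 2 := by ring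
      rw [e]
      exact (dvd_sub hB hA).add ((dvd_pow hpx two_ne_zero).mul_left 22)
    rcases hp.dvd_or_dvd h16 with h2 | h2
    · have h2 := hp.dvd_of_dvd_pow h2
      have hxodd : IsCoprime (2 : ℤ) x := by
        obtain ⟨k, rfl⟩ := hxo
        exact ⟨-k, 1, by ring⟩
      exact hp.not_isUnit (hxodd.isUnit_of_dvd' h2 hpx)
    · exact hp.not_isUnit (hxy.isUnit_of_dvd' hpx (hp.dvd_of_dvd_pow h2))
  obtain ⟨m, n, hm, hn, hmn, hmnc, hAB⟩ :=
    exists_fourth_powers_of_mul_eq (by norm_num) hpos.1 hpos.2 hx hcop hprod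
  obtain ⟨hmo, hno⟩ : Odd m ∧ Odd n := Int.odd_mul.mp (hmn ▸ hxo)
  have hm8 := Int.eight_dvd_sq_sub_one_of_odd hmo
  have hn8 := Int.eight_dvd_sq_sub_one_of_odd hno
  obtain ⟨u, hu⟩ := hm8
  obtain ⟨v, hv⟩ := hn8
  have hmain : m ^ 4 + 22 * m ^ 2 * n ^ 2 - 7 * n ^ 4 = 16 * y ^ 2 := by
    rcases hAB with ⟨hA, hB⟩ | ⟨hB, hA⟩
    · exfalso
      have : -m ^ 4 + 22 * m ^ 2 * n ^ 2 + 7 * n ^ 4 = 16 * y ^ 2 := by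
        push_cast at hB
        rw [← hmn] at hA hB
        linear_combination hA - hB
      have hm2 : m ^ 2 = 8 * u + 1 := by omega
      have hn2 : n ^ 2 = 8 * v + 1 := by omega
      have : -(8 * u + 1) ^ 2 + 22 * (8 * u + 1) * (8 * v + 1) + 7 * (8 * v + 1) ^ 2
          = 16 * y ^ 2 := by
        rw [← hm2, ← hn2, ← this]; ring
      ring_nf at this
      omega
    · push_cast at hA
      rw [← hmn] at hA hB
      linear_combination hA - hB
  obtain ⟨h', hh'⟩ : ∃ h' : ℤ, m ^ 2 + 11 * n ^ 2 = 4 * h' := ⟨2 * u + 22 * v + 3, by linarith⟩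
  have hh'o : Odd h' := ⟨u + 11 * v + 1, by linarith⟩
  have hdiff : h' ^ 2 - y ^ 2 = 8 * n ^ 4 := by
    have : 16 * (h' ^ 2 - y ^ 2) = 16 * (8 * n ^ 4) := by
      linear_combination hmain - (m ^ 2 + 11 * n ^ 2 + 4 * h') * hh'
    linarith
  obtain ⟨s, hs⟩ : ∃ s, h' - y = 2 * s := (hh'o.sub_odd hyo).exists_two_nsmul _ |>.imp (by simp)
  have hst : s * (s + y) = ((2 : ℕ) : ℤ) ^ 1 * n ^ 4 := by
    have hh : h' = 2 * s + y := by linarith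
    rw [hh] at hdiff
    push_cast
    linarith [hdiff]
  have hpos' := pos_of_mul_pos_of_add_pos (A := s) (B := s + y) (by rw [hst]; positivity)
    (by nlinarith)
  have hcop' : IsCoprime s (s + y) := by
    refine isCoprime_of_prime_dvd (by omega) fun p hp hA hB => ?_
    have hpn := prime_dvd_of_mul_eq_prime_mul_pow hp (q := 2) Int.prime_two
      (by simpa using hst) hA hB
    have hpm : p ∣ m ^ 2 := by
      have e : m ^ 2 = 4 * (s + (s + y)) - 11 * n ^ 2 := by linarith
      rw [e]
      exact ((hA.add hB).mul_left 4).sub ((dvd_pow hpn two_ne_zero).mul_left 11)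
    exact hp.not_isUnit (hmnc.isUnit_of_dvd' (hp.dvd_of_dvd_pow hpm) hpn)
  obtain ⟨f, g, hf, hg, hfg, hfgc, hAB'⟩ :=
    exists_fourth_powers_of_mul_eq Nat.prime_two hpos'.1 hpos'.2 hn hcop' hst
  obtain ⟨hfo, hgo⟩ : Odd f ∧ Odd g := Int.odd_mul.mp (hfg ▸ hno)
  have hsum : h' = f ^ 4 + 2 * g ^ 4 := by
    push_cast at hAB'
    rcases hAB' with ⟨h1, h2⟩ | ⟨h1, h2⟩ <;> linarith
  subst hfg
  refine ⟨m, f, g, hm, hf, hg, hfgc.symm, hfo, hgo, hmn.symm, ?_, ?_⟩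
  · rw [hsum] at hh'
    linear_combination -hh'
  · linear_combination hmain

theorem quartic_even_step {x y z : ℤ} (hx : 0 < x) (hz : 0 ≤ z) (hxy : IsCoprime x y)
    (hxe : Even x) (hyo : Odd y) (h : 8 * x ^ 4 - 11 * x ^ 2 * y ^ 2 + 4 * y ^ 4 = z ^ 2) :
    ∃ f g m : ℤ, 0 < f ∧ 0 < g ∧ 2 * g < x ∧ IsCoprime (2 * g) f ∧
      8 * (2 * g) ^ 4 - 11 * (2 * g) ^ 2 * f ^ 2 + 4 * f ^ 4 = m ^ 2 := by
  obtain ⟨w, rfl⟩ := hxe.exists_two_nsmul _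
  obtain ⟨v, rfl⟩ : ∃ v, z = 2 * v := by
    have : Even (z ^ 2) := by
      rw [← h]; exact ⟨2 * (32 * w ^ 4 - 11 * w ^ 2 * y ^ 2 + y ^ 4), by ring⟩
    obtain ⟨v, hv⟩ := (Int.even_pow.mp this).1
    exact ⟨v, by omega⟩
  obtain ⟨u, hu⟩ := Int.eight_dvd_sq_sub_one_of_odd hyo
  have hy2 : y ^ 2 = 8 * u + 1 := by omega
  have h1 : 32 * w ^ 4 - 11 * w ^ 2 * y ^ 2 + y ^ 4 = v ^ 2 := by
    simp only [nsmul_eq_mul, Nat.cast_ofNat] at h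
    linarith
  have hwe : Even w := by
    by_contra hwo
    obtain ⟨t, ht⟩ := Int.eight_dvd_sq_sub_one_of_odd (Int.not_even_iff_odd.mp hwo)
    have hw2 : w ^ 2 = 8 * t + 1 := by omega
    have h2 : 32 * (8 * t + 1) ^ 2 - 11 * (8 * t + 1) * (8 * u + 1) + (8 * u + 1) ^ 2 = v ^ 2 := by
      rw [← hw2, ← hy2, ← h1]; ring
    have h3 : v ^ 2 % 4 = 2 := by rw [← h2]; ring_nf; omega
    rcases Int.even_or_odd v with hv | hv
    · obtain ⟨q, rfl⟩ := hv; ring_nf at h3; omega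
    · have := Int.sq_mod_four_eq_one_of_odd hv; omega
  obtain ⟨k, rfl⟩ : ∃ k, w = 2 * k := hwe.exists_two_nsmul _ |>.imp (by simp)
  simp only [nsmul_eq_mul, Nat.cast_ofNat] at *
  have hk : 0 < k := by omega
  have hvo : Odd v := by
    have : Odd (v ^ 2) := by
      rw [← h1]
      exact Even.add_odd ⟨256 * k ^ 4 - 22 * k ^ 2 * y ^ 2, by ring⟩ hyo.pow
    exact (Int.odd_pow.mp this).resolve_right (by norm_num)
  obtain ⟨A, hA⟩ : ∃ A, v - y ^ 2 + 22 * k ^ 2 = 2 * A := by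
    obtain ⟨q, rfl⟩ := hvo
    exact ⟨q - 4 * u + 11 * k ^ 2, by linarith⟩
  have hprod : A * (v - A) = ((7 : ℕ) : ℤ) ^ 1 * k ^ 4 := by
    push_cast
    have hv' : v = 2 * A + y ^ 2 - 22 * k ^ 2 := by linarith
    rw [hv'] at h1 ⊢
    linarith
  have hv0 : v ≠ 0 := by rintro rfl; simp at hvo
  have hpos := pos_of_mul_pos_of_add_pos (A := A) (B := v - A) (by rw [hprod]; positivity)
    (by omega)
  have hcop : IsCoprime A (v - A) := by
    refine isCoprime_of_prime_dvd (by omega) fun p hp hA' hB' => ?_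
    have hpk := prime_dvd_of_mul_eq_prime_mul_pow hp (q := 7) (by norm_num)
      (by simpa using hprod) hA' hB'
    have hpy : p ∣ y ^ 2 := by
      have e : y ^ 2 = v - A - A + 22 * k ^ 2 := by linarith
      rw [e]
      exact (hB'.sub hA').add ((dvd_pow hpk two_ne_zero).mul_left 22)
    exact hp.not_isUnit (hxy.isUnit_of_dvd' ((hpk.mul_left 2).mul_left 2) (hp.dvd_of_dvd_pow hpy))
  obtain ⟨m, n, hm, hn, hmn, hmnc, hAB⟩ :=
    exists_fourth_powers_of_mul_eq (by norm_num) hpos.1 hpos.2 hk hcop hprod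
  have hmain : m ^ 4 + 22 * m ^ 2 * n ^ 2 - 7 * n ^ 4 = y ^ 2 := by
    push_cast at hAB
    rw [← hmn] at hA
    rcases hAB with ⟨h2, h3⟩ | ⟨h2, h3⟩
    · exfalso
      have h4 : y ^ 2 = 4 * (5 * m ^ 2 * n ^ 2 + 2 * n ^ 4) - (m ^ 2 - n ^ 2) ^ 2 := by
        linear_combination -hA + h3 - h2
      rcases Int.even_or_odd (m ^ 2 - n ^ 2) with hq | hq
      · obtain ⟨q, hq⟩ := hq
        rw [hq] at h4; ring_nf at h4 hy2; omega
      · have := Int.sq_mod_four_eq_one_of_odd hq; omega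
    · linear_combination hA - h2 + h3
  have hHo : Odd (m ^ 2 + 11 * n ^ 2) := by
    have : Odd ((m ^ 2 + 11 * n ^ 2) ^ 2) := by
      have h5 : (m ^ 2 + 11 * n ^ 2) ^ 2 = y ^ 2 + 128 * n ^ 4 := by rw [← hmain]; ring
      rw [h5]
      exact hyo.pow.add_even ⟨64 * n ^ 4, by ring⟩
    exact (Int.odd_pow.mp this).resolve_right (by norm_num)
  obtain ⟨s, hs⟩ : ∃ s, m ^ 2 + 11 * n ^ 2 - y = 2 * s :=
    (hHo.sub_odd hyo).exists_two_nsmul _ |>.imp (by simp)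
  have hst : s * (m ^ 2 + 11 * n ^ 2 - s) = ((2 : ℕ) : ℤ) ^ 5 * n ^ 4 := by
    push_cast
    have hy' : y = m ^ 2 + 11 * n ^ 2 - 2 * s := by linarith
    rw [hy'] at hmain
    linarith
  have hpos' := pos_of_mul_pos_of_add_pos (A := s) (B := m ^ 2 + 11 * n ^ 2 - s)
    (by rw [hst]; positivity) (by ring_nf; positivity)
  have hcop' : IsCoprime s (m ^ 2 + 11 * n ^ 2 - s) := by
    refine isCoprime_of_prime_dvd (by omega) fun p hp hA' hB' => ?_
    have hpH : p ∣ m ^ 2 + 11 * n ^ 2 := by simpa using hA'.add hB'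
    have h6 : p ∣ 2 ^ 5 * n ^ 4 := by
      have := hA'.mul_right (m ^ 2 + 11 * n ^ 2 - s)
      rw [hst] at this; simpa using this
    rcases hp.dvd_or_dvd h6 with h2 | h2
    · obtain ⟨e, he⟩ := hHo
      have h2 := hp.dvd_of_dvd_pow h2
      have : IsCoprime (2 : ℤ) (m ^ 2 + 11 * n ^ 2) := ⟨-e, 1, by rw [he]; ring⟩
      exact hp.not_isUnit (this.isUnit_of_dvd' h2 hpH)
    · have hpn := hp.dvd_of_dvd_pow h2
      have hpm : p ∣ m ^ 2 := by
        simpa using hpH.sub ((dvd_pow hpn two_ne_zero).mul_left 11)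
      exact hp.not_isUnit (hmnc.isUnit_of_dvd' (hp.dvd_of_dvd_pow hpm) hpn)
  obtain ⟨f, g, hf, hg, hfg, hfgc, hAB'⟩ :=
    exists_fourth_powers_of_mul_eq Nat.prime_two hpos'.1 hpos'.2 hn hcop' hst
  have hsum : m ^ 2 + 11 * n ^ 2 = f ^ 4 + 32 * g ^ 4 := by
    push_cast at hAB'
    rcases hAB' with ⟨h2, h3⟩ | ⟨h2, h3⟩ <;> linarith
  have hfo : Odd f := by
    rw [hsum] at hHo
    by_contra hfe
    obtain ⟨q, rfl⟩ := Int.not_odd_iff_even.mp hfe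
    exact Int.not_even_iff_odd.mpr hHo ⟨8 * q ^ 4 + 16 * g ^ 4, by ring⟩
  have h2f : IsCoprime (2 : ℤ) f := by
    obtain ⟨q, rfl⟩ := hfo
    exact ⟨-q, 1, by ring⟩
  refine ⟨f, g, 2 * m, hf, hg, ?_, h2f.mul_left hfgc.symm, ?_⟩
  · have : g ≤ k := by
      rw [← hmn, ← hfg]
      nlinarith [mul_pos hm hf, mul_pos (mul_pos hm hf) hg]
    omega
  · rw [← hfg] at hsum
    linear_combination -4 * hsum

theorem eq_one_of_quartic_eq_sq {x y z : ℤ} (hx : 0 < x) (hy : 0 < y) (hxy : IsCoprime x y)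
    (h : 8 * x ^ 4 - 11 * x ^ 2 * y ^ 2 + 4 * y ^ 4 = z ^ 2) : x = 1 ∧ y = 1 := by
  induction hN : x.toNat using Nat.strong_induction_on generalizing x y z with
  | _ N ih =>
  wlog hz : 0 ≤ z generalizing z
  · exact this (z := -z) (by rw [h]; ring) (by omega)
  rcases Int.even_or_odd x with hxe | hxo
  · have hyo : Odd y := by
      by_contra hye
      obtain ⟨a, rfl⟩ := hxe
      obtain ⟨b, rfl⟩ := Int.not_odd_iff_even.mp hye
      have := hxy.isUnit_of_dvd' (x := 2) ⟨a, by ring⟩ ⟨b, by ring⟩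
      rw [Int.isUnit_iff] at this
      omega
    obtain ⟨f, g, m, hf, hg, hlt, hc, hm⟩ := quartic_even_step hx hz hxy hxe hyo h
    have := (ih (2 * g).toNat (by omega) (by omega) hf hc hm rfl).1
    omega
  · rcases Int.even_or_odd y with hye | hyo
    · exfalso
      obtain ⟨w, rfl⟩ := hye
      obtain ⟨v, rfl⟩ : ∃ v, z = 2 * v := by
        have : Even (z ^ 2) := by
          rw [← h]; exact ⟨4 * x ^ 4 - 22 * x ^ 2 * w ^ 2 + 32 * w ^ 4, by ring⟩
        obtain ⟨v, hv⟩ := (Int.even_pow.mp this).1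
        exact ⟨v, by omega⟩
      obtain ⟨u, hu⟩ := Int.eight_dvd_sq_sub_one_of_odd hxo
      have hx2 : x ^ 2 = 8 * u + 1 := by omega
      have h1 : 2 * (8 * u + 1) ^ 2 - 11 * (8 * u + 1) * w ^ 2 + 16 * w ^ 4 = v ^ 2 := by
        rw [← hx2]; linarith
      have hv4 : v ^ 2 % 4 = 0 ∨ v ^ 2 % 4 = 1 := by
        rcases Int.even_or_odd v with ⟨q, rfl⟩ | hv
        · left; ring_nf; omega
        · right; exact Int.sq_mod_four_eq_one_of_odd hv
      have h2 : v ^ 2 = 4 * (32 * u ^ 2 + 8 * u - 22 * u * w ^ 2 - 3 * w ^ 2 + 4 * w ^ 4)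
          + 2 + w ^ 2 := by
        rw [← h1]; ring
      rcases Int.even_or_odd w with ⟨q, rfl⟩ | hw
      · ring_nf at h2 hv4; omega
      · have := Int.sq_mod_four_eq_one_of_odd hw
        omega
    · obtain ⟨m, f, g, hm, hf, hg, hc, hfo, hgo, rfl, hq, hy2⟩ :=
        quartic_odd_step hx hy hz hxy hxo hyo h
      have hfg1 : f = 1 ∧ g = 1 := by
        by_cases hlt : g < m * (f * g)
        · exact (ih g.toNat (by omega) hg hf hc hq rfl).symm
        · have hmf : m * f ≤ 1 := by
            by_contra hmf
            nlinarith
          have hm1 : m = 1 := by nlinarith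
          have hf1 : f = 1 := by nlinarith
          subst hm1 hf1
          refine ⟨rfl, ?_⟩
          by_contra hg1
          have : 2 ≤ g := by omega
          nlinarith [pow_pos hg 2, mul_self_nonneg (g ^ 2 - 4)]
      obtain ⟨rfl, rfl⟩ := hfg1
      have hm1 : m = 1 := by nlinarith
      subst hm1
      exact ⟨by norm_num, by nlinarith⟩

theorem exists_common_squarefree_part {P Q w : ℤ} (hP : 0 < P) (h : P * Q = w ^ 2) :
    ∃ s x : ℤ, 0 < s ∧ 0 < x ∧ Squarefree s ∧ P = s * x ^ 2 ∧ s ∣ Q := by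
  obtain ⟨s, x, hs, hx, hsx, hsq⟩ := Nat.sq_mul_squarefree_of_pos (n := P.toNat) (by omega)
  have hPs : P = s * (x : ℤ) ^ 2 := by
    rw [← Int.toNat_of_nonneg hP.le, ← hsx]; push_cast; ring
  have hsq' : Squarefree (s : ℤ) := Int.squarefree_natCast.mpr hsq
  refine ⟨s, x, by exact_mod_cast hs, by exact_mod_cast hx, hsq', hPs, ?_⟩
  have hx0 : (x : ℤ) ≠ 0 := by exact_mod_cast hx.ne'
  have hs0 : (s : ℤ) ≠ 0 := by exact_mod_cast hs.ne'
  obtain ⟨v, rfl⟩ : (x : ℤ) ∣ w := by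
    rw [← Int.pow_dvd_pow_iff two_ne_zero, ← h, hPs]
    exact ⟨s * Q, by ring⟩
  have hv : s * Q = v ^ 2 := by
    apply mul_left_cancel₀ (pow_ne_zero 2 hx0)
    rw [hPs] at h
    linear_combination h
  obtain ⟨u, rfl⟩ : (s : ℤ) ∣ v := (hsq'.dvd_pow_iff_dvd two_ne_zero).mp ⟨Q, hv.symm⟩
  refine ⟨u ^ 2, mul_left_cancel₀ hs0 ?_⟩
  linear_combination hv

theorem eq_one_or_two_of_squarefree_of_dvd_eight {s : ℤ} (hs : 0 < s) (hsq : Squarefree s)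
    (h : s ∣ 2 ^ 3) : s = 1 ∨ s = 2 := by
  have h2 := (hsq.dvd_pow_iff_dvd (by norm_num)).mp h
  have := Int.le_of_dvd (by norm_num) h2
  omega

theorem exists_sq_of_mul_sq_eq_sq {k T w : ℤ} (hk : k ≠ 0) (h : k ^ 2 * T = w ^ 2) :
    ∃ z, T = z ^ 2 := by
  obtain ⟨z, rfl⟩ : k ∣ w := (Int.pow_dvd_pow_iff two_ne_zero).mp ⟨T, h.symm⟩
  refine ⟨z, mul_left_cancel₀ (pow_ne_zero 2 hk) ?_⟩
  linear_combination h

theorem eq_one_or_two_of_mul_eq_sq {p r w : ℤ} (hp : 0 < p) (hr : 0 < r) (hpr : IsCoprime p r)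
    (h : p * r * (8 * p ^ 2 - 11 * p * r + 4 * r ^ 2) = w ^ 2) : p = 1 ∧ (r = 1 ∨ r = 2) := by
  obtain ⟨s, x, hs, hx, hsq, hps, hsd⟩ := exists_common_squarefree_part hp
    (show p * (r * (8 * p ^ 2 - 11 * p * r + 4 * r ^ 2)) = w ^ 2 by rw [← h]; ring)
  obtain ⟨s', y, hs', hy, hsq', hrs, hsd'⟩ := exists_common_squarefree_part hr
    (show r * (p * (8 * p ^ 2 - 11 * p * r + 4 * r ^ 2)) = w ^ 2 by rw [← h]; ring)
  have hsp : s ∣ p := ⟨_, hps⟩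
  have hsr : s' ∣ r := ⟨_, hrs⟩
  have hs12 : s = 1 ∨ s = 2 := by
    have hc : IsCoprime s r := hpr.of_isCoprime_of_dvd_left hsp
    have h1 := (hc.dvd_of_dvd_mul_left hsd).sub (hsp.mul_right (8 * p - 11 * r))
    have h2 : s ∣ 4 * r ^ 2 := by
      rwa [show 8 * p ^ 2 - 11 * p * r + 4 * r ^ 2 - p * (8 * p - 11 * r) = 4 * r ^ 2 by ring] at h1
    exact eq_one_or_two_of_squarefree_of_dvd_eight hs hsq
      (((hc.pow_right (n := 2)).dvd_of_dvd_mul_right h2).trans (by norm_num))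
  have hs12' : s' = 1 ∨ s' = 2 := by
    have hc : IsCoprime s' p := hpr.symm.of_isCoprime_of_dvd_left hsr
    have h1 := (hc.dvd_of_dvd_mul_left hsd').sub (hsr.mul_right (4 * r - 11 * p))
    have h2 : s' ∣ 8 * p ^ 2 := by
      rwa [show 8 * p ^ 2 - 11 * p * r + 4 * r ^ 2 - r * (4 * r - 11 * p) = 8 * p ^ 2 by ring] at h1
    exact eq_one_or_two_of_squarefree_of_dvd_eight hs' hsq'
      (((hc.pow_right (n := 2)).dvd_of_dvd_mul_right h2).trans (by norm_num))
  have hxp : x ∣ p := by rw [hps]; exact (dvd_pow_self x two_ne_zero).mul_left s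
  have hyr : y ∣ r := by rw [hrs]; exact (dvd_pow_self y two_ne_zero).mul_left s'
  have hxy : IsCoprime x y :=
    (hpr.of_isCoprime_of_dvd_left hxp).of_isCoprime_of_dvd_right hyr
  have hxy0 : x * y ≠ 0 := (mul_pos hx hy).ne'
  rcases hs12 with rfl | rfl <;> rcases hs12' with rfl | rfl
  · obtain ⟨z, hz⟩ := exists_sq_of_mul_sq_eq_sq
      (T := 8 * x ^ 4 - 11 * x ^ 2 * y ^ 2 + 4 * y ^ 4) (w := w) hxy0
      (by rw [← h, hps, hrs]; ring)
    obtain ⟨rfl, rfl⟩ := eq_one_of_quartic_eq_sq hx hy hxy hz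
    simp [hps, hrs]
  · obtain ⟨z, hz⟩ := exists_sq_of_mul_sq_eq_sq (k := 2 * (x * y))
      (T := 8 * y ^ 4 - 11 * y ^ 2 * x ^ 2 + 4 * x ^ 4) (w := w) (by simpa using hxy0)
      (by rw [← h, hps, hrs]; ring)
    obtain ⟨rfl, rfl⟩ := eq_one_of_quartic_eq_sq hy hx hxy.symm hz
    simp [hps, hrs]
  · exfalso
    obtain ⟨z, hz⟩ := exists_sq_of_mul_sq_eq_sq (k := 2 * (x * y))
      (T := 16 * x ^ 4 - 11 * x ^ 2 * y ^ 2 + 2 * y ^ 4) (w := w) (by simpa using hxy0)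
      (by rw [← h, hps, hrs]; ring)
    have hyo : Odd y := by
      rw [← Int.not_even_iff_odd, even_iff_two_dvd]
      intro h2
      have := hpr.isUnit_of_dvd' hsp (h2.trans hyr)
      rw [Int.isUnit_iff] at this
      omega
    obtain ⟨u, hu⟩ := Int.eight_dvd_sq_sub_one_of_odd hyo
    have hy2 : y ^ 2 = 8 * u + 1 := by omega
    have hz4 : z ^ 2 % 4 = 0 ∨ z ^ 2 % 4 = 1 := by
      rcases Int.even_or_odd z with ⟨q, rfl⟩ | hv
      · left; ring_nf; omega
      · right; exact Int.sq_mod_four_eq_one_of_odd hv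
    have h2 : z ^ 2 = 4 * (4 * x ^ 4 - 22 * x ^ 2 * u - 3 * x ^ 2 + 32 * u ^ 2 + 8 * u)
        + 2 + x ^ 2 := by
      have : y ^ 4 = (8 * u + 1) ^ 2 := by rw [← hy2]; ring
      rw [← hz, this, hy2]; ring
    rcases Int.even_or_odd x with ⟨q, rfl⟩ | hw
    · ring_nf at h2 hz4; omega
    · have := Int.sq_mod_four_eq_one_of_odd hw
      omega
  · exfalso
    have := hpr.isUnit_of_dvd' hsp hsr
    rw [Int.isUnit_iff] at this
    omega

/-- The only rational points of the elliptic curve `a + b + c = -1`, `a * b * c = 1` have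
coordinates `±1`. -/
theorem rat_eq_one_or_neg_one_of_sum_prod {a b c : ℚ} (hsum : a + b + c = -1)
    (hprod : a * b * c = 1) : a = 1 ∨ a = -1 := by
  have ha0 : a ≠ 0 := by rintro rfl; simp at hprod
  by_cases ha1 : a = 1
  · exact .inl ha1
  right
  have hw : a * (a - 1) * (a ^ 2 + 3 * a + 4) = (2 * a * b + a ^ 2 + a) ^ 2 := by
    have hc : c = -1 - a - b := by linarith
    subst hc
    linear_combination 4 * a * hprod
  set p := a.num with hp
  obtain ⟨q, hq⟩ : ∃ q : ℤ, q = a.den := ⟨_, rfl⟩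
  have hq0 : 0 < q := by rw [hq]; exact_mod_cast a.den_pos
  have hpq : IsCoprime p q := by rw [hq]; exact Int.isCoprime_iff_gcd_eq_one.mpr a.reduced
  have haq : a * q = p := by rw [hp, hq]; exact_mod_cast Rat.mul_den_eq_num a
  obtain ⟨w, hw'⟩ : IsSquare (p * (p - q) * (8 * p ^ 2 - 11 * p * (p - q) + 4 * (p - q) ^ 2)) := by
    rw [← Rat.isSquare_intCast_iff]
    refine ⟨(2 * a * b + a ^ 2 + a) * q ^ 2, ?_⟩
    push_cast
    rw [← haq]
    linear_combination (q : ℚ) ^ 4 * hw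
  have hp0 : p ≠ 0 := Rat.num_ne_zero.mpr ha0
  have hr0 : p - q ≠ 0 := by
    intro h
    apply ha1
    have : (q : ℚ) ≠ 0 := by exact_mod_cast hq0.ne'
    apply mul_right_cancel₀ this
    rw [haq, one_mul]
    exact_mod_cast (by omega : p = q)
  have hpos : 0 < p * (p - q) := by
    have hT : 0 < 8 * p ^ 2 - 11 * p * (p - q) + 4 * (p - q) ^ 2 := by
      nlinarith [sq_nonneg (2 * p + 3 * q), pow_pos hq0 2]
    have h0 : 0 ≤ p * (p - q) := nonneg_of_mul_nonneg_left (hw' ▸ mul_self_nonneg w) hT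
    exact lt_of_le_of_ne h0 (mul_ne_zero hp0 hr0).symm
  have hcop : IsCoprime p (p - q) := by
    have := hpq.neg_right.add_mul_left_right 1
    rwa [show -q + p * 1 = p - q by ring] at this
  have hqp : q = -p := by
    rcases mul_pos_iff.mp hpos with ⟨h1, h2⟩ | ⟨h1, h2⟩
    · have := eq_one_or_two_of_mul_eq_sq h1 h2 hcop (w := w) (by rw [hw']; ring)
      omega
    · have := eq_one_or_two_of_mul_eq_sq (neg_pos.mpr h1) (neg_pos.mpr h2) hcop.neg_neg (w := w)
        (by rw [← pow_two] at hw'; rw [← hw']; ring)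
      omega
  have : (q : ℚ) ≠ 0 := by exact_mod_cast hq0.ne'
  apply mul_right_cancel₀ this
  rw [haq, hqp]; push_cast; ring

theorem rat_two_eq_neg_one_of_sum_prod {a b c : ℚ} (hsum : a + b + c = -1)
    (hprod : a * b * c = 1) :
    (a = -1 ∧ b = -1) ∨ (b = -1 ∧ c = -1) ∨ (c = -1 ∧ a = -1) := by
  have ha := rat_eq_one_or_neg_one_of_sum_prod hsum hprod
  have hb := rat_eq_one_or_neg_one_of_sum_prod (a := b) (b := c) (c := a)
    (by rw [← hsum]; ring) (by rw [← hprod]; ring)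
  rcases ha with rfl | rfl <;> rcases hb with rfl | rfl <;>
    first
    | (exfalso; linarith)
    | (have : c = -1 := by linarith
       simp [this])
    | simp

theorem exists_conj_of_finrank_eq_two {K : Type*} [Field K] [NumberField K]
    (hdeg : Module.finrank ℚ K = 2) :
    ∃ σ : K →+* K, (∀ x, σ (σ x) = x) ∧ ∀ x, σ x = x → ∃ q : ℚ, (q : K) = x := by
  have : Algebra.IsQuadraticExtension ℚ K := ⟨hdeg⟩
  have hcard : Nat.card Gal(K/ℚ) = 2 := (IsGalois.card_aut_eq_finrank ℚ K).trans hdeg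
  obtain ⟨σ, hσ, huniq⟩ := (Nat.card_eq_two_iff' (1 : Gal(K/ℚ))).mp hcard
  refine ⟨(σ : K →+* K), fun x => ?_, fun x hx => ?_⟩
  · have h1 : σ * σ = 1 := by
      by_contra h
      exact hσ (mul_eq_left.mp (huniq _ h))
    exact DFunLike.congr_fun h1 x
  · obtain ⟨q, hq⟩ := (IsGalois.mem_range_algebraMap_iff_fixed (F := ℚ) x).mpr fun f => by
      by_cases hf : f = 1
      · simp [hf]
      · rw [huniq f hf]; exact hx
    exact ⟨q, by simpa using hq⟩

section Conjugation

variable {K : Type*} [Field K] [CharZero K] {σ : K →+* K}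

theorem mul_conj_eq_eight_of_collinear {a b c μ : K} (hμ : σ μ = μ) (ha : σ a ≠ a)
    (hsum : a + b + c = -1) (hprod : a * b * c = 1) (hb : b + 1 = μ * (a + 1))
    (hD : (1 + a) * (1 + b) * (1 + c) ≠ 0) :
    (1 + a) * (1 + b) * (1 + c) * σ ((1 + a) * (1 + b) * (1 + c)) = 8 := by
  obtain ⟨A, hA⟩ : ∃ A, A = 1 + a := ⟨_, rfl⟩
  have ha' : a = A - 1 := by rw [hA]; ring
  have hb' : b = μ * A - 1 := by rw [hA]; linear_combination hb
  have hc' : c = 1 - (1 + μ) * A := by linear_combination hsum - ha' - hb'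
  have hDA : (1 + a) * (1 + b) * (1 + c) = μ * A ^ 2 * (2 - (1 + μ) * A) := by
    rw [ha', hb', hc']; ring
  rw [hDA] at hD ⊢
  have hA0 : A ≠ 0 := by rintro rfl; simp at hD
  have hμ0 : μ ≠ 0 := by rintro rfl; simp at hD
  have hquad : μ * (1 + μ) * A ^ 2 - (μ ^ 2 + 3 * μ + 1) * A + 2 * (1 + μ) = 0 := by
    rw [ha', hb', hc'] at hprod
    apply mul_left_cancel₀ hA0
    linear_combination -hprod
  have hquad' : μ * (1 + μ) * σ A ^ 2 - (μ ^ 2 + 3 * μ + 1) * σ A + 2 * (1 + μ) = 0 := by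
    have := congrArg σ hquad
    simpa only [map_sub, map_add, map_mul, map_pow, map_one, map_ofNat, map_zero, hμ] using this
  have hne : A - σ A ≠ 0 := by
    intro h
    apply ha
    rw [ha']
    simp only [map_sub, map_one]
    linear_combination -h
  have h1μ : 1 + μ ≠ 0 := by
    intro h
    apply hA0
    have hμ1 : μ = -1 := by linear_combination h
    rw [hμ1] at hquad
    linear_combination hquad
  have htr : μ * (1 + μ) * (A + σ A) = μ ^ 2 + 3 * μ + 1 := by
    apply mul_left_cancel₀ hne
    linear_combination hquad - hquad'
  have hnm : μ * (A * σ A) = 2 := by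
    apply mul_left_cancel₀ h1μ
    linear_combination A * htr - hquad
  have hlast : (2 - (1 + μ) * A) * (2 - (1 + μ) * σ A) = 2 := by
    apply mul_left_cancel₀ hμ0
    linear_combination -2 * htr + (1 + μ) ^ 2 * hnm
  simp only [map_mul, map_pow, map_sub, map_add, map_one, map_ofNat, hμ]
  linear_combination (μ * (A * σ A) + 2) *
      ((2 - (1 + μ) * A) * (2 - (1 + μ) * σ A)) * hnm + 4 * hlast

theorem rational_or_mul_conj_eq_eight {a b c : K} (hσ : ∀ x, σ (σ x) = x)
    (hfix : ∀ x, σ x = x → ∃ q : ℚ, (q : K) = x)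
    (hsum : a + b + c = -1) (hprod : a * b * c = 1) (hD : (1 + a) * (1 + b) * (1 + c) ≠ 0) :
    (∃ κ d : ℚ, (d : K) = (1 + a) * (1 + b) * (1 + c) ∧ κ ^ 3 + κ ^ 2 + (d - 1) * κ - 1 = 0) ∨
      (1 + a) * (1 + b) * (1 + c) * σ ((1 + a) * (1 + b) * (1 + c)) = 8 := by
  have rational_case : ∀ {a b c : K}, a + b + c = -1 → a * b * c = 1 → σ a = a →
      ∃ κ d : ℚ, (d : K) = (1 + a) * (1 + b) * (1 + c) ∧
        κ ^ 3 + κ ^ 2 + (d - 1) * κ - 1 = 0 := by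
    intro a b c hsum hprod ha
    obtain ⟨κ, rfl⟩ := hfix a ha
    have hκ : (κ : K) ≠ 0 := by intro h; simp [h] at hprod
    have hκ' : κ ≠ 0 := by exact_mod_cast hκ
    refine ⟨κ, (1 + κ) * (κ⁻¹ - κ), ?_, by field_simp; ring⟩
    push_cast
    field_simp
    linear_combination -(1 + κ) * κ * hsum - (1 + κ) * hprod
  by_cases ha : σ a = a
  · exact .inl (rational_case hsum hprod ha)
  by_cases hb : σ b = b
  · obtain ⟨κ, d, hd, h⟩ := rational_case (a := b) (b := c) (c := a)
      (by rw [← hsum]; ring) (by rw [← hprod]; ring) hb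
    exact .inl ⟨κ, d, by rw [hd]; ring, h⟩
  by_cases hc : σ c = c
  · obtain ⟨κ, d, hd, h⟩ := rational_case (a := c) (b := a) (c := b)
      (by rw [← hsum]; ring) (by rw [← hprod]; ring) hc
    exact .inl ⟨κ, d, by rw [hd]; ring, h⟩
  right
  have hsum' : σ a + σ b + σ c = -1 := by simpa using congrArg σ hsum
  have hprod' : σ a * σ b * σ c = 1 := by simpa using congrArg σ hprod
  have hane : σ a - a ≠ 0 := sub_ne_zero.mpr ha
  have hane' : a - σ a ≠ 0 := sub_ne_zero.mpr (Ne.symm ha)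
  obtain ⟨μ, hμ⟩ : ∃ μ, μ = (σ b - b) / (σ a - a) := ⟨_, rfl⟩
  have hμ' : σ b - b = μ * (σ a - a) := by rw [hμ]; field_simp
  have hσμ : σ μ = μ := by
    rw [hμ]
    simp only [map_div₀, map_sub, hσ]
    rw [div_eq_div_iff hane' hane]
    ring
  have hμ0 : μ ≠ 0 := by
    rintro rfl
    exact hb (by linear_combination hμ')
  have hμ1 : 1 + μ ≠ 0 := by
    intro h
    exact hc (by linear_combination hsum' - hsum - hμ' - (σ a - a) * h)
  obtain ⟨ν, hν⟩ : ∃ ν, ν = b - μ * a := ⟨_, rfl⟩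
  have hσν : σ ν = ν := by
    rw [hν]
    simp only [map_sub, map_mul, hσμ]
    linear_combination hμ'
  have hb' : b = μ * a + ν := by rw [hν]; ring
  have hc' : c = -(1 + μ) * a - 1 - ν := by linear_combination hsum - hb'
  have hσb : σ b = μ * σ a + ν := by rw [hb']; simp [hσμ, hσν]
  have hσc : σ c = -(1 + μ) * σ a - 1 - ν := by linear_combination hsum' - hσb
  rw [hb', hc'] at hprod
  rw [hσb, hσc] at hprod'
  obtain ⟨a', ha'⟩ : ∃ a', a' = -(μ * (1 + ν) + ν * (1 + μ)) / (μ * (1 + μ)) - (a + σ a) :=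
    ⟨_, rfl⟩
  have ha'μ : μ * (1 + μ) * (a' + a + σ a) = -(μ * (1 + ν) + ν * (1 + μ)) := by
    rw [ha']; field_simp; ring
  have hσa' : σ a' = a' := by
    rw [ha']
    simp only [map_sub, map_add, map_div₀, map_neg, map_mul, map_one, hσμ, hσν, hσ]
    ring
  have hline : a' * (μ * a' + ν) * (-(1 + μ) * a' - 1 - ν) = 1 := by
    have hdd : -μ * (1 + μ) * (a ^ 2 + a * σ a + σ a ^ 2)
        - (μ * (1 + ν) + ν * (1 + μ)) * (a + σ a) - ν * (1 + ν) = 0 := by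
      apply mul_left_cancel₀ hane'
      linear_combination hprod - hprod'
    linear_combination hprod + (a' - a) * hdd - (a' - a) * (a' - σ a) * ha'μ
  obtain ⟨q, rfl⟩ := hfix a' hσa'
  obtain ⟨m, rfl⟩ := hfix μ hσμ
  obtain ⟨n, rfl⟩ := hfix ν hσν
  have hQ : q * (m * q + n) * (-(1 + m) * q - 1 - n) = 1 := by exact_mod_cast hline
  have hD' : (1 + b) * (1 + c) * (1 + a) ≠ 0 := by convert hD using 1; ring
  have hD'' : (1 + c) * (1 + a) * (1 + b) ≠ 0 := by convert hD using 1; ring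
  have hprod₀ : a * b * c = 1 := by rw [hb', hc']; exact hprod
  rcases rat_two_eq_neg_one_of_sum_prod (by ring) hQ with ⟨h1, h2⟩ | ⟨h1, h2⟩ | ⟨h1, h2⟩
  · refine mul_conj_eq_eight_of_collinear (μ := m) hσμ ha hsum hprod₀ ?_ hD
    have h3 : (m : K) * q + n = -1 := by exact_mod_cast h2
    have h4 : (q : K) = -1 := by exact_mod_cast h1
    linear_combination hb' + h3 - m * h4
  · have := mul_conj_eq_eight_of_collinear (μ := -(1 + m) / m) (a := b) (b := c) (c := a)
      (by simp [hσμ]) hb (by rw [← hsum]; ring) (by rw [← hprod₀]; ring) ?_ hD'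
    · rw [← this]; simp only [map_mul]; ring
    · have h3 : (m : K) * q + n = -1 := by exact_mod_cast h1
      have h4 : -(1 + (m : K)) * q - 1 - n = -1 := by exact_mod_cast h2
      field_simp
      linear_combination m * hc' + m * h4 + (1 + m) * hb' + (1 + m) * h3
  · have := mul_conj_eq_eight_of_collinear (μ := -(1 + m : K)⁻¹) (a := c) (b := a) (c := b)
      (by simp [hσμ]) hc (by rw [← hsum]; ring) (by rw [← hprod₀]; ring) ?_ hD''
    · rw [← this]; simp only [map_mul]; ring
    · have h3 : -(1 + (m : K)) * q - 1 - n = -1 := by exact_mod_cast h1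
      have h4 : (q : K) = -1 := by exact_mod_cast h2
      field_simp
      linear_combination hc' + h3 + (1 + m) * h4

end Conjugation

theorem sq_ne_one_of_cubic_root {κ d : ℚ} (h : κ ^ 3 + κ ^ 2 + (d - 1) * κ - 1 = 0) :
    d ^ 2 ≠ 1 := by
  intro hd
  obtain ⟨e, he, rfl⟩ : ∃ e : ℤ, (e = 1 ∨ e = -1) ∧ (e : ℚ) = d := by
    rcases (sq_eq_sq_iff_eq_or_eq_neg (b := (1 : ℚ))).mp (by rw [hd, one_pow]) with rfl | rfl
    · exact ⟨1, by simp⟩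
    · exact ⟨-1, by simp⟩
  have hκ : IsIntegral ℤ κ := by
    refine ⟨.X ^ 3 + (.X ^ 2 + .C (e - 1) * .X - 1), ?_, ?_⟩
    · monicity!
    · simp only [Polynomial.eval₂_add, Polynomial.eval₂_sub, Polynomial.eval₂_mul,
        Polynomial.eval₂_pow, Polynomial.eval₂_X, Polynomial.eval₂_C, Polynomial.eval₂_one]
      push_cast
      simp
      linear_combination h
  obtain ⟨n, rfl⟩ := IsIntegrallyClosed.isIntegral_iff.mp hκ
  have hn : n * (n ^ 2 + n + (e - 1)) = 1 := by
    have : (n : ℚ) ^ 3 + n ^ 2 + (e - 1) * n - 1 = 0 := by simpa using h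
    have : n ^ 3 + n ^ 2 + (e - 1) * n - 1 = 0 := by exact_mod_cast this
    linear_combination this
  rcases Int.isUnit_iff.mp (IsUnit.of_mul_eq_one _ hn) with rfl | rfl <;> omega

theorem rat_sq_ne_eight (q : ℚ) : q ^ 2 ≠ 8 := by
  intro h
  have h2 : (q / 2 : ℝ) ^ 2 = 2 := by
    have : (q : ℝ) ^ 2 = 8 := by exact_mod_cast h
    linear_combination this / 4
  apply irrational_sqrt_two
  refine ⟨|q / 2|, ?_⟩
  rw [← h2, Real.sqrt_sq_eq_abs]
  push_cast
  rfl

section Cycles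

variable {K : Type*} [Field K]

/-- `x ↦ y ↦ z ↦ x` is a cycle of length three under `fc c`. -/
structure IsThreeCycle (c x y z : K) : Prop where
  map_fst : x ^ 2 + c = y
  map_snd : y ^ 2 + c = z
  map_thd : z ^ 2 + c = x
  fst_ne_snd : x ≠ y

namespace IsThreeCycle

variable {c x y z u v w : K}

theorem rotate (h : IsThreeCycle c x y z) : IsThreeCycle c y z x := by
  refine ⟨h.map_snd, h.map_thd, h.map_fst, fun hyz => h.fst_ne_snd ?_⟩
  have h1 := h.map_snd
  have h2 := h.map_thd
  rw [hyz] at h1 ⊢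
  rw [← h2, h1]

theorem map (h : IsThreeCycle c x y z) {σ : K →+* K} (hc : σ c = c) :
    IsThreeCycle c (σ x) (σ y) (σ z) := by
  refine ⟨?_, ?_, ?_, σ.injective.ne h.fst_ne_snd⟩
  · rw [← h.map_fst, map_add, map_pow, hc]
  · rw [← h.map_snd, map_add, map_pow, hc]
  · rw [← h.map_thd, map_add, map_pow, hc]

theorem add_mul_add (h : IsThreeCycle c x y z) : 1 + (x + y) + (x + y) * (y + z) = 0 := by
  have h1 : y - z = (x - y) * (x + y) := by linear_combination h.map_snd - h.map_fst
  have h2 : z - x = (y - z) * (y + z) := by linear_combination h.map_thd - h.map_snd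
  apply mul_left_cancel₀ (sub_ne_zero.mpr h.fst_ne_snd)
  linear_combination -(1 + y + z) * h1 - h2

/-- Two cycles with distinct starting points: the product of the termwise sums is one. -/
theorem prod_add_eq_one (h : IsThreeCycle c x y z) (h' : IsThreeCycle c u v w) (hne : x ≠ u) :
    (x + u) * (y + v) * (z + w) = 1 := by
  have h1 : y - v = (x - u) * (x + u) := by linear_combination h'.map_fst - h.map_fst
  have h2 : z - w = (y - v) * (y + v) := by linear_combination h'.map_snd - h.map_snd
  have h3 : x - u = (z - w) * (z + w) := by linear_combination h'.map_thd - h.map_thd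
  apply mul_left_cancel₀ (sub_ne_zero.mpr hne)
  rw [h2, h1] at h3
  linear_combination -h3

theorem conj_eq_self (h : IsThreeCycle c x y z) {σ : K →+* K} (hc : σ c = c) (hσ : ∀ x, σ (σ x) = x)
    (hx : σ x = x ∨ σ x = y ∨ σ x = z) : σ x = x ∧ σ y = y ∧ σ z = z := by
  have hm := h.map hc
  have hy : σ x ^ 2 + c = σ y := hm.map_fst
  have hz : σ y ^ 2 + c = σ z := hm.map_snd
  rcases hx with hx | hx | hx
  · rw [hx, h.map_fst] at hy
    rw [← hy, h.map_snd] at hz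
    exact ⟨hx, hy.symm, hz.symm⟩
  · rw [hx, h.map_snd, ← hx, hσ] at hy
    exact absurd hy h.rotate.rotate.fst_ne_snd
  · rw [hx, h.map_thd] at hy
    rw [← hy, h.map_fst, ← hx, hσ] at hz
    exact absurd hz.symm h.fst_ne_snd

theorem hasExactPeriod (h : IsThreeCycle c x y z) : HasExactPeriod c 3 x := by
  refine ⟨?_, fun j h1 h3 => ?_⟩
  · simp [fc, h.map_fst, h.map_snd, h.map_thd]
  · interval_cases j
    · simpa [fc, h.map_fst] using h.fst_ne_snd.symm
    · simpa [fc, h.map_fst, h.map_snd] using h.rotate.rotate.fst_ne_snd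

theorem _root_.HasExactPeriod.isThreeCycle (h : HasExactPeriod c 3 x) :
    IsThreeCycle c x (x ^ 2 + c) ((x ^ 2 + c) ^ 2 + c) :=
  ⟨rfl, rfl, h.1, (h.2 1 le_rfl (by norm_num)).symm⟩

variable [CharZero K]

theorem exists_param (h : IsThreeCycle c x y z) :
    ∃ t : K, t * (t + 1) * (t ^ 2 + t + 1) ≠ 0 ∧
      x = (t ^ 3 + 2 * t ^ 2 + t + 1) / (2 * t * (t + 1)) ∧
      y = (t ^ 3 - t - 1) / (2 * t * (t + 1)) ∧
      z = -(t ^ 3 + 2 * t ^ 2 + 3 * t + 1) / (2 * t * (t + 1)) ∧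
      c = -(t ^ 6 + 2 * t ^ 5 + 4 * t ^ 4 + 8 * t ^ 3 + 9 * t ^ 2 + 4 * t + 1) /
          (4 * t ^ 2 * (t + 1) ^ 2) := by
  obtain ⟨t, ht⟩ : ∃ t, t = x + y := ⟨_, rfl⟩
  have e1 := h.add_mul_add
  have e2 := h.rotate.add_mul_add
  rw [← ht] at e1
  have ht0 : t ≠ 0 := by rintro rfl; simp at e1
  have hr : y + z = -(t + 1) / t := by
    field_simp; linear_combination e1
  have ht1 : t + 1 ≠ 0 := by
    intro h1
    simp [hr, h1] at e2
  have hp : z + x = -1 / (t + 1) := by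
    rw [hr] at e2
    field_simp at e2 ⊢
    linear_combination -e2
  have hx : x = (t ^ 3 + 2 * t ^ 2 + t + 1) / (2 * t * (t + 1)) := by
    have : x = (t + -1 / (t + 1) - -(t + 1) / t) / 2 := by rw [← hr, ← hp, ht]; ring
    rw [this]; field_simp; ring
  have hy : y = (t ^ 3 - t - 1) / (2 * t * (t + 1)) := by
    have : y = t - x := by rw [ht]; ring
    rw [this, hx]; field_simp; ring
  have hz : z = -(t ^ 3 + 2 * t ^ 2 + 3 * t + 1) / (2 * t * (t + 1)) := by
    have : z = -1 / (t + 1) - x := by rw [← hp]; ring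
    rw [this, hx]; field_simp; ring
  refine ⟨t, mul_ne_zero (mul_ne_zero ht0 ht1) fun h2 => h.fst_ne_snd ?_, hx, hy, hz, ?_⟩
  · rw [hx, hy]
    congr 1
    linear_combination 2 * h2
  · have : c = y - x ^ 2 := by rw [← h.map_fst]; ring
    rw [this, hx, hy]; field_simp; ring

theorem of_param {t : K} (ht : t * (t + 1) * (t ^ 2 + t + 1) ≠ 0) :
    IsThreeCycle (-(t ^ 6 + 2 * t ^ 5 + 4 * t ^ 4 + 8 * t ^ 3 + 9 * t ^ 2 + 4 * t + 1) /
        (4 * t ^ 2 * (t + 1) ^ 2))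
      ((t ^ 3 + 2 * t ^ 2 + t + 1) / (2 * t * (t + 1)))
      ((t ^ 3 - t - 1) / (2 * t * (t + 1)))
      (-(t ^ 3 + 2 * t ^ 2 + 3 * t + 1) / (2 * t * (t + 1))) := by
  obtain ⟨⟨ht0, ht1⟩, ht2⟩ : (t ≠ 0 ∧ t + 1 ≠ 0) ∧ t ^ 2 + t + 1 ≠ 0 := by
    simpa only [mul_ne_zero_iff] using ht
  refine ⟨by field_simp; ring, by field_simp; ring, by field_simp; ring, fun h => ht2 ?_⟩
  field_simp at h
  linear_combination h / 2

theorem sum_sq_add_sum (h : IsThreeCycle c x y z) :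
    (x + y + z) ^ 2 + (x + y + z) + c + 2 = 0 := by
  obtain ⟨t, ht, rfl, rfl, rfl, rfl⟩ := h.exists_param
  obtain ⟨⟨ht0, ht1⟩, -⟩ : (t ≠ 0 ∧ t + 1 ≠ 0) ∧ t ^ 2 + t + 1 ≠ 0 := by
    simpa only [mul_ne_zero_iff] using ht
  field_simp
  ring

theorem sum_mul (h : IsThreeCycle c x y z) :
    x * y + y * z + z * x = -((x + y + z) ^ 2 + 2 * (x + y + z) + 3) := by
  obtain ⟨t, ht, rfl, rfl, rfl, rfl⟩ := h.exists_param
  obtain ⟨⟨ht0, ht1⟩, -⟩ : (t ≠ 0 ∧ t + 1 ≠ 0) ∧ t ^ 2 + t + 1 ≠ 0 := by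
    simpa only [mul_ne_zero_iff] using ht
  field_simp
  ring

theorem prod_eq (h : IsThreeCycle c x y z) :
    x * y * z = -((x + y + z) ^ 3 + 2 * (x + y + z) ^ 2 + 3 * (x + y + z) + 1) := by
  obtain ⟨t, ht, rfl, rfl, rfl, rfl⟩ := h.exists_param
  obtain ⟨⟨ht0, ht1⟩, -⟩ : (t ≠ 0 ∧ t + 1 ≠ 0) ∧ t ^ 2 + t + 1 ≠ 0 := by
    simpa only [mul_ne_zero_iff] using ht
  field_simp
  ring

theorem prod_one_add_add (h : IsThreeCycle c x y z) :
    (1 + x + y) * (1 + y + z) * (1 + z + x) = -1 := by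
  obtain ⟨t, ht, rfl, rfl, rfl, rfl⟩ := h.exists_param
  obtain ⟨⟨ht0, ht1⟩, -⟩ : (t ≠ 0 ∧ t + 1 ≠ 0) ∧ t ^ 2 + t + 1 ≠ 0 := by
    simpa only [mul_ne_zero_iff] using ht
  field_simp
  ring

theorem prod_sub_eq (h : IsThreeCycle c x y z) (s : K) :
    (s - x) * (s - y) * (s - z) = s ^ 3 - (x + y + z) * s ^ 2
      - ((x + y + z) ^ 2 + 2 * (x + y + z) + 3) * s
      + ((x + y + z) ^ 3 + 2 * (x + y + z) ^ 2 + 3 * (x + y + z) + 1) := by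
  linear_combination s * h.sum_mul - h.prod_eq

theorem eq_of_sum_eq (h : IsThreeCycle c x y z) (h' : IsThreeCycle c u v w)
    (hsum : u + v + w = x + y + z) : u = x ∨ u = y ∨ u = z := by
  have h0 : (u - x) * (u - y) * (u - z) = 0 := by
    rw [h.prod_sub_eq, ← hsum, ← h'.prod_sub_eq]; ring
  simpa [mul_eq_zero, sub_eq_zero, or_assoc] using h0

theorem sum_eq_or (h : IsThreeCycle c x y z) (h' : IsThreeCycle c u v w) :
    u + v + w = x + y + z ∨ u + v + w = -1 - (x + y + z) := by
  have h0 : (u + v + w - (x + y + z)) * (u + v + w + 1 + (x + y + z)) = 0 := by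
    linear_combination h'.sum_sq_add_sum - h.sum_sq_add_sum
  rcases mul_eq_zero.mp h0 with h1 | h1
  · exact .inl (by linear_combination h1)
  · exact .inr (by linear_combination h1)

theorem prod_one_add_add_eq (h : IsThreeCycle c x y z) (h' : IsThreeCycle c u v w)
    (hsum : u + v + w = -1 - (x + y + z)) :
    (1 + u + x) * (1 + u + y) * (1 + u + z) = 2 * (1 + u + v) := by
  have h1 := h.prod_sub_eq (-(1 + u))
  have h2 := h'.prod_sub_eq u
  rw [hsum] at h2
  linear_combination -h1 - h2 + 2 * h'.map_fst - 2 * h.sum_sq_add_sum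

/-- The three products of `1 + a`, over the sums `a` of matched terms of two complementary
cycles, multiply to `-8`. -/
theorem prod_matchings (h : IsThreeCycle c x y z) (h' : IsThreeCycle c u v w)
    (hsum : u + v + w = -1 - (x + y + z)) :
    ((1 + (x + u)) * (1 + (y + v)) * (1 + (z + w))) *
      ((1 + (y + u)) * (1 + (z + v)) * (1 + (x + w))) *
      ((1 + (z + u)) * (1 + (x + v)) * (1 + (y + w))) = -8 := by
  have h1 := h.prod_one_add_add_eq h' hsum
  have h2 := h.prod_one_add_add_eq h'.rotate (by rw [← hsum]; ring)
  have h3 := h.prod_one_add_add_eq h'.rotate.rotate (by rw [← hsum]; ring)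
  calc _ = ((1 + u + x) * (1 + u + y) * (1 + u + z)) * ((1 + v + x) * (1 + v + y) * (1 + v + z)) *
        ((1 + w + x) * (1 + w + y) * (1 + w + z)) := by ring
    _ = 8 * ((1 + u + v) * (1 + v + w) * (1 + w + u)) := by rw [h1, h2, h3]; ring
    _ = -8 := by rw [h'.prod_one_add_add]; norm_num

theorem sum_matchings (h : IsThreeCycle c x y z) (h' : IsThreeCycle c u v w)
    (hsum : u + v + w = -1 - (x + y + z)) (hx : x ≠ u) (hy : y ≠ u) (hz : z ≠ u) :
    (1 + (x + u)) * (1 + (y + v)) * (1 + (z + w)) +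
      (1 + (y + u)) * (1 + (z + v)) * (1 + (x + w)) +
      (1 + (z + u)) * (1 + (x + v)) * (1 + (y + w)) = 8 * c + 4 := by
  have h1 := h.prod_add_eq_one h' hx
  have h2 := h.rotate.prod_add_eq_one h' hy
  have h3 := h.rotate.rotate.prod_add_eq_one h' hz
  have h4 := h'.sum_mul
  rw [hsum] at h4
  linear_combination h1 + h2 + h3 + 3 * h4 + 3 * h.sum_mul
    + (3 + 2 * (x + y + z)) * hsum - 8 * h.sum_sq_add_sum

end IsThreeCycle

variable [CharZero K] {σ : K →+* K}

theorem conj_eq_self_of_prod_eq_neg_eight {D E F : K} (hprod : D * E * F = -8)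
    (hD : (∃ κ d : ℚ, (d : K) = D ∧ κ ^ 3 + κ ^ 2 + (d - 1) * κ - 1 = 0) ∨ D * σ D = 8)
    (hE : (∃ κ d : ℚ, (d : K) = E ∧ κ ^ 3 + κ ^ 2 + (d - 1) * κ - 1 = 0) ∨ E * σ E = 8)
    (hF : (∃ κ d : ℚ, (d : K) = F ∧ κ ^ 3 + κ ^ 2 + (d - 1) * κ - 1 = 0) ∨ F * σ F = 8) :
    σ D = D ∧ σ E = E ∧ σ F = F := by
  have hnorm : (D * σ D) * (E * σ E) * (F * σ F) = 64 := by
    have h := congrArg σ hprod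
    simp only [map_mul, map_neg, map_ofNat] at h
    calc _ = (D * E * F) * (σ D * σ E * σ F) := by ring
      _ = 64 := by rw [hprod, h]; norm_num
  have one_rational : ∀ {κ d : ℚ}, κ ^ 3 + κ ^ 2 + (d - 1) * κ - 1 = 0 →
      (64 : K) * d ^ 2 ≠ 64 := fun {κ d} h1 h2 => sq_ne_one_of_cubic_root h1 (by
    have : (64 : ℚ) * d ^ 2 = 64 := by exact_mod_cast h2
    linear_combination this / 64)
  have two_rational : ∀ d e : ℚ, (8 : K) * (d * e) ^ 2 ≠ 64 := fun d e h =>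
    rat_sq_ne_eight (d * e) (by
      have : (8 : ℚ) * (d * e) ^ 2 = 64 := by exact_mod_cast h
      linear_combination this / 8)
  rcases hD with ⟨κ, d, rfl, hd⟩ | hD <;> rcases hE with ⟨μ, e, rfl, he⟩ | hE <;>
    rcases hF with ⟨ν, f, rfl, hf⟩ | hF <;> try simp only [map_ratCast] at hnorm ⊢
  · simp
  · rw [hF] at hnorm
    exact absurd (by linear_combination hnorm) (two_rational d e)
  · rw [hE] at hnorm
    exact absurd (by linear_combination hnorm) (two_rational d f)
  · rw [hE, hF] at hnorm
    exact absurd (by linear_combination hnorm) (one_rational hd)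
  · rw [hD] at hnorm
    exact absurd (by linear_combination hnorm) (two_rational e f)
  · rw [hD, hF] at hnorm
    exact absurd (by linear_combination hnorm) (one_rational he)
  · rw [hD, hE] at hnorm
    exact absurd (by linear_combination hnorm) (one_rational hf)
  · rw [hD, hE, hF] at hnorm
    norm_num at hnorm

theorem prod_one_add_eq_zero_of_fixed {a b c : K}
    (hfix : ∀ x, σ x = x → ∃ q : ℚ, (q : K) = x) (hsum : a + b + c = -1) (hprod : a * b * c = 1)
    (ha : σ a = a) (hb : σ b = b) (hc : σ c = c) : (1 + a) * (1 + b) * (1 + c) = 0 := by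
  obtain ⟨a, rfl⟩ := hfix a ha
  obtain ⟨b, rfl⟩ := hfix b hb
  obtain ⟨c, rfl⟩ := hfix c hc
  rcases rat_two_eq_neg_one_of_sum_prod (a := a) (b := b) (c := c) (by exact_mod_cast hsum)
    (by exact_mod_cast hprod) with h | h | h <;> simp [h.1]

namespace IsThreeCycle

variable {c x y z u v w : K}

/-- Over a field with an involution whose fixed field is `ℚ`, all points of exact period three
lie on a single cycle. -/
theorem eq_of_conj (hσ : ∀ x, σ (σ x) = x) (hfix : ∀ x, σ x = x → ∃ q : ℚ, (q : K) = x)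
    (h : IsThreeCycle c x y z) (h' : IsThreeCycle c u v w) : u = x ∨ u = y ∨ u = z := by
  by_contra hu
  have hsum : u + v + w = -1 - (x + y + z) :=
    (h.sum_eq_or h').resolve_left fun hs => hu (h.eq_of_sum_eq h' hs)
  push Not at hu
  obtain ⟨hx, hy, hz⟩ := hu
  have hS := h.sum_matchings h' hsum hx.symm hy.symm hz.symm
  have hP := h.prod_matchings h' hsum
  have p1 := h.prod_add_eq_one h' hx.symm
  have p2 := h.rotate.prod_add_eq_one h' hy.symm
  have p3 := h.rotate.rotate.prod_add_eq_one h' hz.symm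
  have s1 : (x + u) + (y + v) + (z + w) = -1 := by linear_combination hsum
  have s2 : (y + u) + (z + v) + (x + w) = -1 := by linear_combination hsum
  have s3 : (z + u) + (x + v) + (y + w) = -1 := by linear_combination hsum
  have hne := hP.trans_ne (by norm_num : (-8 : K) ≠ 0)
  have d3 := right_ne_zero_of_mul hne
  have d2 := right_ne_zero_of_mul (left_ne_zero_of_mul hne)
  have d1 := left_ne_zero_of_mul (left_ne_zero_of_mul hne)
  obtain ⟨r1, r2, r3⟩ := conj_eq_self_of_prod_eq_neg_eight hP
    (rational_or_mul_conj_eq_eight hσ hfix s1 p1 d1)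
    (rational_or_mul_conj_eq_eight hσ hfix s2 p2 d2)
    (rational_or_mul_conj_eq_eight hσ hfix s3 p3 d3)
  have hc : σ c = c := by
    have h1 := congrArg σ hS
    rw [map_add, map_add, r1, r2, r3, hS] at h1
    simp only [map_add, map_mul, map_ofNat] at h1
    linear_combination -h1 / 8
  have n1 := fun ha hb hc => d1 (prod_one_add_eq_zero_of_fixed hfix s1 p1 ha hb hc)
  have n2 := fun ha hb hc => d2 (prod_one_add_eq_zero_of_fixed hfix s2 p2 ha hb hc)
  have n3 := fun ha hb hc => d3 (prod_one_add_eq_zero_of_fixed hfix s3 p3 ha hb hc)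
  simp only [map_add] at n1 n2 n3
  have hm := h'.map hc
  have hv := hm.map_fst
  have hw := hm.map_snd
  rcases h'.sum_eq_or hm with hs | hs
  · obtain ⟨fu, fv, fw⟩ := h'.conj_eq_self hc hσ (h'.eq_of_sum_eq hm hs)
    have hs' := congrArg σ hsum
    simp only [map_add, map_sub, map_neg, map_one, fu, fv, fw] at hs'
    obtain ⟨fx, fy, fz⟩ := h.conj_eq_self hc hσ
      (h.eq_of_sum_eq (h.map hc) (by linear_combination hs' - hsum))
    exact n1 (by rw [fx, fu]) (by rw [fy, fv]) (by rw [fz, fw])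
  · have swap : ∀ {a b : K}, σ a = b → σ b + σ a = b + a := fun {a b} hab => by
      rw [← hab, hσ, add_comm]
    rcases h.eq_of_sum_eq hm (by linear_combination hs - hsum) with hu | hu | hu
    · rw [hu, h.map_fst] at hv
      rw [← hv, h.map_snd] at hw
      exact n1 (swap hu) (swap hv.symm) (swap hw.symm)
    · rw [hu, h.map_snd] at hv
      rw [← hv, h.map_thd] at hw
      exact n2 (swap hu) (swap hv.symm) (swap hw.symm)
    · rw [hu, h.map_thd] at hv
      rw [← hv, h.map_fst] at hw
      exact n3 (swap hu) (swap hv.symm) (swap hw.symm)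

end IsThreeCycle

end Cycles

theorem period_three_parametrization {K : Type*} [Field K] [NumberField K]
    (hdeg : Module.finrank ℚ K = 2) (c : K) :
    (∀ α : K, HasExactPeriod c 3 α ↔
      ∃ t : K, t * (t + 1) * (t ^ 2 + t + 1) ≠ 0 ∧
        α = (t ^ 3 + 2 * t ^ 2 + t + 1) / (2 * t * (t + 1)) ∧
        c = -(t ^ 6 + 2 * t ^ 5 + 4 * t ^ 4 + 8 * t ^ 3 + 9 * t ^ 2 + 4 * t + 1) /
            (4 * t ^ 2 * (t + 1) ^ 2)) ∧
    (∀ t : K, t * (t + 1) * (t ^ 2 + t + 1) ≠ 0 →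
      c = -(t ^ 6 + 2 * t ^ 5 + 4 * t ^ 4 + 8 * t ^ 3 + 9 * t ^ 2 + 4 * t + 1) /
          (4 * t ^ 2 * (t + 1) ^ 2) →
      ∀ A B C : K,
        A = (t ^ 3 + 2 * t ^ 2 + t + 1) / (2 * t * (t + 1)) →
        B = (t ^ 3 - t - 1) / (2 * t * (t + 1)) →
        C = -(t ^ 3 + 2 * t ^ 2 + 3 * t + 1) / (2 * t * (t + 1)) →
        {α : K | HasExactPeriod c 3 α} = {A, B, C} ∧
        A ≠ B ∧ A ≠ C ∧ B ≠ C ∧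
        fc c A = B ∧ fc c B = C ∧ fc c C = A) := by
  refine ⟨fun α => ⟨fun hα => ?_, ?_⟩, fun t ht hc A B C hA hB hC => ?_⟩
  · obtain ⟨t, ht, h1, -, -, h2⟩ := hα.isThreeCycle.exists_param
    exact ⟨t, ht, h1, h2⟩
  · rintro ⟨t, ht, rfl, rfl⟩
    exact (IsThreeCycle.of_param ht).hasExactPeriod
  · have h : IsThreeCycle c A B C := by
      rw [hc, hA, hB, hC]; exact IsThreeCycle.of_param ht
    obtain ⟨σ, hσ, hfix⟩ := exists_conj_of_finrank_eq_two hdeg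
    refine ⟨Set.ext fun α => ⟨fun hα => ?_, ?_⟩, h.fst_ne_snd, h.rotate.rotate.fst_ne_snd.symm,
      h.rotate.fst_ne_snd, h.map_fst, h.map_snd, h.map_thd⟩
    · exact h.eq_of_conj hσ hfix (HasExactPeriod.isThreeCycle hα)
    · rintro (rfl | rfl | rfl)
      · exact h.hasExactPeriod
      · exact h.rotate.hasExactPeriod
      · exact h.rotate.rotate.hasExactPeriod
end

section
/- Let K be a number field of degree at most 2 over ℚ. Then the only solutions (t,u) ∈ K × K of the equation t(t+1)u³ + (t³+2t²−t−1)u² + (t³−t²−4t−1)u − t(t+1) = 0 are the four points (0,−1), (0,0), (−1,0), and (−1,−1). -/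
/-- A nonnegative factor of a `2j`-th power, coprime to its cofactor, is itself such a power. -/
lemma Int.eq_pow_of_isCoprime_of_mul_eq_pow {F G b : ℤ} {k : ℕ} (hk : Even k) (hF : 0 ≤ F)
    (hc : IsCoprime F G) (h : F * G = b ^ k) : ∃ m : ℤ, F = m ^ k := by
  obtain ⟨m, hm⟩ := exists_associated_pow_of_mul_eq_pow' hc h
  have hm0 : 0 ≤ m ^ k := hk.pow_nonneg m
  rcases Int.associated_iff.mp hm with h1 | h1 <;> exact ⟨m, by lia⟩

/-- Coprime nonnegative integers whose product is a fourth power are fourth powers. -/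
lemma Int.exists_fourth_pow_of_mul_eq {F G b : ℤ} (hF : 0 ≤ F) (hG : 0 ≤ G)
    (hc : IsCoprime F G) (h : F * G = b ^ 4) :
    ∃ m n : ℤ, F = m ^ 4 ∧ G = n ^ 4 ∧ b ^ 2 = m ^ 2 * n ^ 2 := by
  have h4 : Even 4 := by decide
  obtain ⟨m, hm⟩ := Int.eq_pow_of_isCoprime_of_mul_eq_pow h4 hF hc h
  obtain ⟨n, hn⟩ := Int.eq_pow_of_isCoprime_of_mul_eq_pow h4 hG hc.symm (mul_comm F G ▸ h)
  refine ⟨m, n, hm, hn, ?_⟩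
  have h1 : (b ^ 2) ^ 2 = (m ^ 2 * n ^ 2) ^ 2 := by
    subst hm hn
    linear_combination -h
  rwa [sq_eq_sq₀ (by positivity) (by positivity)] at h1

/-- Coprime nonnegative integers with product `7 b⁴` are, in some order, `m⁴` and `7 n⁴`. -/
lemma Int.exists_fourth_pow_of_mul_eq_seven {F G b : ℤ} (hF : 0 ≤ F) (hG : 0 ≤ G)
    (hc : IsCoprime F G) (h : F * G = 7 * b ^ 4) :
    ∃ m n : ℤ, b ^ 2 = m ^ 2 * n ^ 2 ∧
      ((F = m ^ 4 ∧ G = 7 * n ^ 4) ∨ (F = 7 * n ^ 4 ∧ G = m ^ 4)) := by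
  have h7 : Prime (7 : ℤ) := by norm_num
  rcases h7.dvd_or_dvd (Dvd.intro _ h.symm) with ⟨F', rfl⟩ | ⟨G', rfl⟩
  · obtain ⟨n, m, h1, h2, h3⟩ := Int.exists_fourth_pow_of_mul_eq (F := F') (b := b) (by lia) hG
      hc.of_mul_left_right (by linarith)
    exact ⟨m, n, by rw [h3, mul_comm], Or.inr ⟨by rw [h1], h2⟩⟩
  · obtain ⟨m, n, h1, h2, h3⟩ := Int.exists_fourth_pow_of_mul_eq (G := G') (b := b) hF (by lia)
      hc.of_mul_right_right (by linarith)
    exact ⟨m, n, h3, Or.inl ⟨h1, by rw [h2]⟩⟩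

/-- A prime whose square divides `7 b⁴` divides `b`. -/
lemma Prime.dvd_of_mul_self_dvd_seven_mul {p b : ℤ} (hp : Prime p) (h : p * p ∣ 7 * b ^ 4) :
    p ∣ b := by
  by_contra hb
  have hcop : IsCoprime (p * p) (b ^ 4) := by
    have := (hp.coprime_iff_not_dvd.mpr hb).pow_right (n := 4)
    exact this.mul_left this
  have h7 : Prime (7 : ℤ) := by norm_num
  exact hp.not_isUnit (h7.irreducible.squarefree p (hcop.dvd_of_dvd_mul_right h))

lemma Int.isCoprime_two_of_odd {n : ℤ} (hn : Odd n) : IsCoprime 2 n := by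
  rwa [Int.prime_two.coprime_iff_not_dvd, ← even_iff_two_dvd, Int.not_even_iff_odd]

/-- Coprime nonnegative integers of odd sum with product `2ᵏ n⁴` are `r⁴` and `2ᵏ s⁴`. -/
lemma Int.exists_fourth_pow_of_mul_eq_two_pow {f g n : ℤ} (k : ℕ) (hf : 0 ≤ f) (hg : 0 ≤ g)
    (hc : IsCoprime f g) (hodd : Odd (f + g)) (h : f * g = 2 ^ k * n ^ 4) :
    ∃ r s : ℤ, Odd r ∧ IsCoprime r s ∧ n ^ 2 = r ^ 2 * s ^ 2 ∧ f + g = r ^ 4 + 2 ^ k * s ^ 4 := by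
  wlog hgodd : Odd g generalizing f g
  · have hfodd : Odd f := by
      rw [Int.not_odd_iff_even] at hgodd
      exact (Int.odd_add.mp hodd).mpr hgodd
    obtain ⟨r, s, h1, h2, h3, h4⟩ := this hg hf hc.symm (by rwa [add_comm]) (by rw [← h]; ring) hfodd
    exact ⟨r, s, h1, h2, h3, by rw [← h4]; ring⟩
  have h2k : IsCoprime ((2 : ℤ) ^ k) g := (Int.isCoprime_two_of_odd hgodd).pow_left
  obtain ⟨f', rfl⟩ := h2k.dvd_of_dvd_mul_right (Dvd.intro _ h.symm)
  have hc' := hc.of_mul_left_right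
  have hpos : (0 : ℤ) < 2 ^ k := by positivity
  obtain ⟨s, r, rfl, rfl, h3⟩ := Int.exists_fourth_pow_of_mul_eq (F := f') (b := n)
    (nonneg_of_mul_nonneg_right hf hpos) hg hc' (mul_left_cancel₀ hpos.ne' (by rw [← h]; ring))
  exact ⟨r, s, (Int.odd_pow' (by norm_num)).mp hgodd,
    ((IsCoprime.pow_iff (by norm_num) (by norm_num)).mp hc').symm, by rw [h3, mul_comm], by ring⟩

/-- Two integers of odd nonnegative sum whose product is `2ᵏ n⁴` and whose sum divides
`m² + 11 n²`, with `m` and `n` coprime, are `r⁴` and `2ᵏ s⁴`. -/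
lemma Int.exists_fourth_pow_of_mul_sum_eq {f g m n j : ℤ} (k : ℕ) (hmn : IsCoprime m n)
    (hn : n ≠ 0) (hodd : Odd (f + g)) (hsum : j * (f + g) = m ^ 2 + 11 * n ^ 2)
    (h0 : 0 ≤ f + g) (h : f * g = 2 ^ k * n ^ 4) :
    ∃ r s : ℤ, Odd r ∧ IsCoprime r s ∧ n ^ 2 = r ^ 2 * s ^ 2 ∧ f + g = r ^ 4 + 2 ^ k * s ^ 4 := by
  have hpos : 0 < f * g := by rw [h]; positivity
  have hf : 0 ≤ f := by
    by_contra hneg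
    nlinarith
  have hg : 0 ≤ g := by
    by_contra hneg
    nlinarith
  refine Int.exists_fourth_pow_of_mul_eq_two_pow k hf hg ?_ hodd h
  refine isCoprime_of_prime_dvd (fun h0 => ?_) (fun p hp d1 d2 => ?_)
  · simp [h0.1] at hpos
  · have d3 : p ∣ f + g := dvd_add d1 d2
    have d4 : p ∣ n := by
      rcases hp.dvd_or_dvd (h ▸ d1.mul_right g) with h5 | h5
      · exact absurd ((Int.isCoprime_two_of_odd hodd).isUnit_of_dvd' (hp.dvd_of_dvd_pow h5) d3)
          hp.not_isUnit
      · exact hp.dvd_of_dvd_pow h5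
    have d5 : p ∣ m ^ 2 := by
      rw [show m ^ 2 = j * (f + g) - n * (11 * n) by rw [hsum]; ring]
      exact dvd_sub (d3.mul_left _) (d4.mul_right _)
    exact hp.not_isUnit (hmn.isUnit_of_dvd' (hp.dvd_of_dvd_pow d5) d4)

/-- The descent step for solutions with even second coordinate. -/
lemma quartic_descent_even {a β c : ℤ} (hab : IsCoprime a β) (ha : Odd a) (hc : 0 ≤ c)
    (hβ : β ≠ 0) (h : a ^ 4 - 44 * a ^ 2 * β ^ 2 + 512 * β ^ 4 = c ^ 2) :
    ∃ r s m : ℤ, Odd r ∧ IsCoprime r s ∧ s ≠ 0 ∧ s ^ 2 ≤ β ^ 2 ∧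
      r ^ 4 - 11 * r ^ 2 * s ^ 2 + 32 * s ^ 4 = m ^ 2 := by
  have hβ4 : 0 < β ^ 4 := by positivity
  have hcodd : Odd c := by
    have h1 : Odd (a ^ 4) := ha.pow
    have : Odd (c ^ 2) := by
      rw [← h]
      obtain ⟨z, hz⟩ := h1
      exact ⟨z - 22 * a ^ 2 * β ^ 2 + 256 * β ^ 4, by rw [hz]; ring⟩
    exact (Int.odd_pow' (by norm_num)).mp this
  have ha2 : Odd (a ^ 2) := ha.pow
  obtain ⟨f, hf⟩ : ∃ f, c - a ^ 2 + 22 * β ^ 2 = 2 * f := by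
    obtain ⟨z, hz⟩ := hcodd.sub_odd ha2
    exact ⟨z + 11 * β ^ 2, by linear_combination hz⟩
  have hfg : f * (c - f) = 7 * β ^ 4 := by
    have h1 : 4 * (f * (c - f)) = 4 * (7 * β ^ 4) := by
      linear_combination (-2 * c + 2 * f + (c - a ^ 2 + 22 * β ^ 2)) * hf - h
    linarith
  have hf0 : 0 ≤ f := by
    by_contra hneg
    nlinarith
  have hg0 : 0 ≤ c - f := by
    by_contra hneg
    nlinarith
  have hcop : IsCoprime f (c - f) := by
    refine isCoprime_of_prime_dvd (fun h0 => ?_) (fun p hp h1 h2 => ?_)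
    · rw [h0.1, zero_mul] at hfg
      lia
    · have hpβ : p ∣ β := hp.dvd_of_mul_self_dvd_seven_mul (hfg ▸ mul_dvd_mul h1 h2)
      have hpa : p ∣ a ^ 2 := by
        have : a ^ 2 = (c - f) - f + β * (22 * β) := by linear_combination -hf
        rw [this]
        exact dvd_add (dvd_sub h2 h1) (hpβ.mul_right _)
      exact hp.not_isUnit (hab.isUnit_of_dvd' (hp.dvd_of_dvd_pow hpa) hpβ)
  obtain ⟨m, n, hmn, ⟨h1, h2⟩ | ⟨h1, h2⟩⟩ :=
    Int.exists_fourth_pow_of_mul_eq_seven hf0 hg0 hcop hfg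
  · exfalso
    have key : ∀ a m n : ZMod 8, 4 * a = 4 → 4 * (m ^ 4 + 7 * n ^ 4) = 4 →
      a ^ 2 ≠ 22 * m ^ 2 * n ^ 2 + 7 * n ^ 4 - m ^ 4 := by decide
    have e1 : ((4 * a : ℤ) : ZMod 8) = ((4 : ℤ) : ZMod 8) := by
      obtain ⟨z, rfl⟩ := ha
      rw [ZMod.intCast_eq_intCast_iff_dvd_sub]
      exact ⟨-z, by push_cast; ring⟩
    have e2 : ((4 * (m ^ 4 + 7 * n ^ 4) : ℤ) : ZMod 8) = ((4 : ℤ) : ZMod 8) := by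
      rw [show m ^ 4 + 7 * n ^ 4 = c by lia]
      obtain ⟨z, rfl⟩ := hcodd
      rw [ZMod.intCast_eq_intCast_iff_dvd_sub]
      exact ⟨-z, by push_cast; ring⟩
    have e3 : ((a ^ 2 : ℤ) : ZMod 8) = ((22 * m ^ 2 * n ^ 2 + 7 * n ^ 4 - m ^ 4 : ℤ) : ZMod 8) := by
      congr 1
      linear_combination h2 - h1 + 22 * hmn - hf
    push_cast at e1 e2 e3
    exact key a m n e1 e2 e3
  have hmn' : IsCoprime m n := by
    rw [h2, h1] at hcop
    exact ((IsCoprime.pow_iff (by norm_num) (by norm_num)).mp hcop.of_mul_left_right).symm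
  have hodd : Odd (m ^ 2 + 11 * n ^ 2) := by
    have : Odd (m ^ 4 + 7 * n ^ 4) := by rwa [show m ^ 4 + 7 * n ^ 4 = c by lia]
    simpa [Int.odd_add, Int.even_mul, Int.even_pow, Int.odd_mul, Int.odd_pow,
      show Odd (11 : ℤ) by decide, show ¬ Even (11 : ℤ) by decide,
      show ¬ Even (7 : ℤ) by decide] using this
  obtain ⟨w, hw⟩ : ∃ w, m ^ 2 + 11 * n ^ 2 - a = 2 * w := by
    obtain ⟨z, hz⟩ := hodd.sub_odd ha
    exact ⟨z, by linear_combination hz⟩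
  have ha2' : a ^ 2 = m ^ 4 + 22 * m ^ 2 * n ^ 2 - 7 * n ^ 4 := by
    linear_combination h2 - h1 + 22 * hmn - hf
  have hwg : w * (m ^ 2 + 11 * n ^ 2 - w) = 32 * n ^ 4 := by
    have : 4 * (w * (m ^ 2 + 11 * n ^ 2 - w)) = 4 * (32 * n ^ 4) := by
      linear_combination (-(m ^ 2 + 11 * n ^ 2) - a + 2 * w) * hw - ha2'
    linarith
  have hn0 : n ≠ 0 := by
    rintro rfl
    have : β ^ 2 = 0 := by rw [hmn]; ring
    exact hβ (by simpa using this)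
  have hm0 : m ≠ 0 := by
    rintro rfl
    have : β ^ 2 = 0 := by rw [hmn]; ring
    exact hβ (by simpa using this)
  obtain ⟨r, s, hr, hrs, hnrs, hsum⟩ := Int.exists_fourth_pow_of_mul_sum_eq (f := w)
    (g := m ^ 2 + 11 * n ^ 2 - w) (j := 1) 5 hmn' hn0 (by simpa using hodd) (by ring)
    (by rw [add_sub_cancel]; positivity) (by rw [hwg]; norm_num)
  have hr0 : r ≠ 0 := by rintro rfl; simp at hr
  have hs0 : s ≠ 0 := by
    rintro rfl
    exact hn0 (by simpa using hnrs)
  refine ⟨r, s, m, hr, hrs, hs0, ?_, by linear_combination -hsum + 11 * hnrs⟩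
  have hm1 : 0 < m ^ 2 := by positivity
  have hr1 : 0 < r ^ 2 := by positivity
  have hs1 : 0 < s ^ 2 := by positivity
  rw [hmn, hnrs, ← mul_assoc]
  exact le_mul_of_one_le_left hs1.le (Int.add_one_le_iff.mpr (mul_pos hm1 hr1))

/-- The descent step for solutions with odd second coordinate. -/
lemma quartic_descent_odd {a b c : ℤ} (hab : IsCoprime a b) (hb : Odd b) (hc : 0 ≤ c)
    (h : a ^ 4 - 11 * a ^ 2 * b ^ 2 + 32 * b ^ 4 = c ^ 2) :
    ∃ r s m n : ℤ, Odd s ∧ IsCoprime r s ∧ n ^ 2 = r ^ 2 * s ^ 2 ∧ b ^ 2 = m ^ 2 * n ^ 2 ∧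
      4 * a ^ 2 = m ^ 4 + 22 * m ^ 2 * n ^ 2 - 7 * n ^ 4 ∧
      4 * r ^ 4 - 11 * r ^ 2 * s ^ 2 + 8 * s ^ 4 = m ^ 2 := by
  have hb0 : b ≠ 0 := by rintro rfl; simp at hb
  have hb4 : 0 < b ^ 4 := by positivity
  have hFG : (2 * c - 2 * a ^ 2 + 11 * b ^ 2) * (2 * c + 2 * a ^ 2 - 11 * b ^ 2) = 7 * b ^ 4 := by
    linear_combination -4 * h
  have hFodd : Odd (2 * c - 2 * a ^ 2 + 11 * b ^ 2) := by
    obtain ⟨z, hz⟩ : Odd (11 * b ^ 2) := (by decide : Odd (11 : ℤ)).mul hb.pow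
    exact ⟨c - a ^ 2 + z, by linear_combination hz⟩
  have hcop : IsCoprime (2 * c - 2 * a ^ 2 + 11 * b ^ 2) (2 * c + 2 * a ^ 2 - 11 * b ^ 2) := by
    refine isCoprime_of_prime_dvd (fun h0 => ?_) (fun p hp h1 h2 => ?_)
    · rw [h0.1, zero_mul] at hFG
      lia
    · have hpb : p ∣ b := hp.dvd_of_mul_self_dvd_seven_mul (hFG ▸ mul_dvd_mul h1 h2)
      have hpa : p ∣ 2 ^ 2 * a ^ 2 := by
        have : 2 ^ 2 * a ^ 2 = (2 * c + 2 * a ^ 2 - 11 * b ^ 2) - (2 * c - 2 * a ^ 2 + 11 * b ^ 2)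
          + b * (22 * b) := by ring
        rw [this]
        exact dvd_add (dvd_sub h2 h1) (hpb.mul_right _)
      rcases hp.dvd_or_dvd hpa with h5 | h5
      · exact hp.not_isUnit
          ((Int.isCoprime_two_of_odd hFodd).isUnit_of_dvd' (hp.dvd_of_dvd_pow h5) h1)
      · exact hp.not_isUnit (hab.isUnit_of_dvd' (hp.dvd_of_dvd_pow h5) hpb)
  have hF0 : 0 ≤ 2 * c - 2 * a ^ 2 + 11 * b ^ 2 := by
    by_contra hneg
    nlinarith
  have hG0 : 0 ≤ 2 * c + 2 * a ^ 2 - 11 * b ^ 2 := by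
    by_contra hneg
    nlinarith
  obtain ⟨m, n, hmn, hcase⟩ := Int.exists_fourth_pow_of_mul_eq_seven hF0 hG0 hcop hFG
  obtain ⟨hm, hn⟩ : Odd m ∧ Odd n := by
    have : Odd (m ^ 2 * n ^ 2) := hmn ▸ hb.pow
    rw [Int.odd_mul] at this
    exact this.imp (Int.odd_pow' (by norm_num)).mp (Int.odd_pow' (by norm_num)).mp
  obtain ⟨m₁, hm₁⟩ := Int.eight_dvd_sq_sub_one_of_odd hm
  obtain ⟨n₁, hn₁⟩ := Int.eight_dvd_sq_sub_one_of_odd hn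
  rw [sub_eq_iff_eq_add] at hm₁ hn₁
  rcases hcase with ⟨h1, h2⟩ | ⟨h1, h2⟩
  · exfalso
    have h3 : a ^ 2 = 4 * (11 * (8 * m₁ * n₁ + m₁ + n₁) + 7 * (4 * n₁ ^ 2 + n₁)
        - (4 * m₁ ^ 2 + m₁)) + 7 := by
      have : 4 * a ^ 2 = 22 * m ^ 2 * n ^ 2 + 7 * (n ^ 2) ^ 2 - (m ^ 2) ^ 2 := by
        linear_combination h2 - h1 + 22 * hmn
      rw [hm₁, hn₁] at this
      linarith
    rcases Int.even_or_odd a with ⟨z, rfl⟩ | hodd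
    · lia
    · have := Int.sq_mod_four_eq_one_of_odd hodd
      lia
  have ha4 : 4 * a ^ 2 = m ^ 4 + 22 * m ^ 2 * n ^ 2 - 7 * n ^ 4 := by
    linear_combination h2 - h1 + 22 * hmn
  have hmn' : IsCoprime m n := by
    rw [h2, h1] at hcop
    exact ((IsCoprime.pow_iff (by norm_num) (by norm_num)).mp hcop.of_mul_left_right).symm
  have h16 : a ^ 2 = 4 * (1 + 11 * (8 * m₁ * n₁ + m₁ + n₁) - 7 * (4 * n₁ ^ 2 + n₁)
      + (4 * m₁ ^ 2 + m₁)) := by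
    have : 4 * a ^ 2 = (m ^ 2) ^ 2 + 22 * (m ^ 2 * n ^ 2) - 7 * (n ^ 2) ^ 2 := by
      linear_combination ha4
    rw [hm₁, hn₁] at this
    linarith
  obtain ⟨e, he⟩ : Even a := by
    by_contra hodd
    have := Int.sq_mod_four_eq_one_of_odd (Int.not_even_iff_odd.mp hodd)
    lia
  have he' : a = 2 * e := by lia
  have hprod : (3 + 2 * m₁ + 22 * n₁ - e) * (3 + 2 * m₁ + 22 * n₁ + e) = 8 * n ^ 4 := by
    have h6 : 4 * (3 + 2 * m₁ + 22 * n₁) = m ^ 2 + 11 * n ^ 2 := by lia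
    have : 16 * ((3 + 2 * m₁ + 22 * n₁ - e) * (3 + 2 * m₁ + 22 * n₁ + e)) = 16 * (8 * n ^ 4) := by
      subst he'
      linear_combination (m ^ 2 + 11 * n ^ 2 + 4 * (3 + 2 * m₁ + 22 * n₁)) * h6 - ha4
    linarith
  have hodde : Odd e := by
    by_contra hev
    obtain ⟨z, rfl⟩ := Int.not_odd_iff_even.mp hev
    have : Odd ((3 + 2 * m₁ + 22 * n₁ - (z + z)) * (3 + 2 * m₁ + 22 * n₁ + (z + z))) :=
      Odd.mul ⟨1 + m₁ + 11 * n₁ - z, by ring⟩ ⟨1 + m₁ + 11 * n₁ + z, by ring⟩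
    rw [hprod, ← Int.not_even_iff_odd] at this
    exact this ⟨4 * n ^ 4, by ring⟩
  obtain ⟨i, rfl⟩ := hodde
  have hfg : (1 + m₁ + 11 * n₁ - i) * (2 + m₁ + 11 * n₁ + i) = 2 ^ 1 * n ^ 4 := by
    linarith
  have hsum : 4 * ((1 + m₁ + 11 * n₁ - i) + (2 + m₁ + 11 * n₁ + i)) = m ^ 2 + 11 * n ^ 2 := by
    lia
  have hsum0 : 0 ≤ (1 + m₁ + 11 * n₁ - i) + (2 + m₁ + 11 * n₁ + i) := by
    have : 0 ≤ m ^ 2 + 11 * n ^ 2 := by positivity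
    lia
  obtain ⟨r, s, -, hrs, hnrs, hrs4⟩ := Int.exists_fourth_pow_of_mul_sum_eq 1 hmn'
    (by rintro rfl; simp at hn) ⟨1 + m₁ + 11 * n₁, by ring⟩ hsum hsum0 hfg
  have hs : Odd s := by
    have : Odd (r ^ 2 * s ^ 2) := hnrs ▸ hn.pow
    exact (Int.odd_pow' (by norm_num)).mp (Int.odd_mul.mp this).2
  refine ⟨r, s, m, n, hs, hrs, hnrs, hmn, ha4, ?_⟩
  rw [hrs4] at hsum
  linear_combination hsum + 11 * hnrs

/-- The integral points on the quartic that covers `Y² = X (X² - 11 X + 32)`, by infinite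
descent. -/
theorem quartic_points {a b c : ℤ} (hab : IsCoprime a b)
    (h : a ^ 4 - 11 * a ^ 2 * b ^ 2 + 32 * b ^ 4 = c ^ 2) : b = 0 ∨ (a ^ 2 = 4 ∧ b ^ 2 = 1) := by
  induction hN : b.natAbs using Nat.strong_induction_on generalizing a b c with
  | _ N ih =>
  subst hN
  by_cases hb0 : b = 0
  · exact Or.inl hb0
  right
  wlog hc : 0 ≤ c generalizing c
  · exact this (c := -c) (by linear_combination h) (by lia)
  rcases Int.even_or_odd' b with ⟨β, rfl | hβ⟩
  · exfalso
    have hβ0 : β ≠ 0 := by rintro rfl; simp at hb0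
    have hcop2 : IsCoprime a 2 := hab.of_mul_right_left
    have ha : Odd a := by
      rw [← Int.not_even_iff_odd, even_iff_two_dvd, ← Int.prime_two.coprime_iff_not_dvd]
      exact hcop2.symm
    obtain ⟨r, s, m, hr, hrs, hs0, hsβ, hq⟩ := quartic_descent_even hab.of_mul_right_right ha hc hβ0
      (by linear_combination h)
    have hlt : s.natAbs < (2 * β).natAbs := by
      rw [Int.natAbs_lt_iff_sq_lt]
      have : 0 < β ^ 2 := by positivity
      nlinarith
    rcases ih _ hlt hrs hq rfl with h1 | ⟨h1, -⟩
    · exact hs0 h1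
    · have : Odd (r ^ 2) := hr.pow
      rw [h1] at this
      exact absurd this (by decide)
  · obtain ⟨r, s, m, n, hs, hrs, hn, hb, ha, hq⟩ := quartic_descent_odd hab ⟨β, hβ⟩ hc h
    suffices hrs1 : r ^ 2 = 1 ∧ s ^ 2 = 1 by
      obtain ⟨hr1, hs1⟩ := hrs1
      have hn1 : n ^ 2 = 1 := by rw [hn, hr1, hs1]; rfl
      have hm1 : m ^ 2 = 1 := by
        rw [← hq]
        linear_combination (4 * r ^ 2 + 4 - 11 * s ^ 2) * hr1 + (8 * s ^ 2 - 3) * hs1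
      refine ⟨?_, by rw [hb, hm1, hn1]; rfl⟩
      have : 4 * a ^ 2 = 16 := by
        rw [ha]
        linear_combination (m ^ 2 + 1 + 22 * n ^ 2) * hm1 + (15 - 7 * n ^ 2) * hn1
      lia
    by_cases hlt : s.natAbs < b.natAbs
    · have hcop : IsCoprime (2 * r) s := (Int.isCoprime_two_of_odd hs).mul_left hrs
      rcases ih _ hlt hcop (c := 2 * m) (by linear_combination 4 * hq) rfl with h1 | ⟨h1, h2⟩
      · rw [h1] at hs
        simp at hs
      · exact ⟨by linarith, h2⟩
    · rw [Int.natAbs_lt_iff_sq_lt, not_lt, hb, hn] at hlt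
      have hb2 : 0 < b ^ 2 := by positivity
      rw [hb, hn] at hb2
      have hm0 : 0 < m ^ 2 := by
        by_contra h0
        have : m ^ 2 = 0 := le_antisymm (not_lt.mp h0) (sq_nonneg m)
        simp [this] at hb2
      have hs0 : 0 < s ^ 2 := by
        by_contra h0
        have : s ^ 2 = 0 := le_antisymm (not_lt.mp h0) (sq_nonneg s)
        simp [this] at hb2
      have hr0 : 0 < r ^ 2 := by
        by_contra h0
        have : r ^ 2 = 0 := le_antisymm (not_lt.mp h0) (sq_nonneg r)
        simp [this] at hb2
      have hle : m ^ 2 * r ^ 2 ≤ 1 := by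
        by_contra h1
        nlinarith
      have hm1 : m ^ 2 = 1 := by nlinarith
      have hr1 : r ^ 2 = 1 := by nlinarith
      refine ⟨hr1, ?_⟩
      have h8 : (s ^ 2 - 1) * (8 * s ^ 2 - 3) = 0 := by
        linear_combination hq + hm1 - (4 * r ^ 2 + 4 - 11 * s ^ 2) * hr1
      rcases mul_eq_zero.mp h8 with h9 | h9 <;> lia

/-- A rational number whose square is an integer is an integer. -/
lemma Rat.exists_int_of_sq_eq_int {z : ℚ} {n : ℤ} (h : z ^ 2 = n) : ∃ c : ℤ, (c : ℚ) = z :=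
  IsIntegrallyClosed.exists_algebraMap_eq_of_isIntegral_pow (R := ℤ) two_pos
    (h ▸ isIntegral_algebraMap)

/-- Rational points of `z² = s⁴ - 11 s² + 32`. -/
lemma sq_eq_four_of_quartic {s z : ℚ} (h : z ^ 2 = s ^ 4 - 11 * s ^ 2 + 32) : s ^ 2 = 4 := by
  have hd : (s.den : ℚ) ≠ 0 := by exact_mod_cast s.den_nz
  have hs : s * s.den = s.num := Rat.mul_den_eq_num s
  have hz : (z * (s.den : ℚ) ^ 2) ^ 2 =
      ((s.num ^ 4 - 11 * s.num ^ 2 * (s.den : ℤ) ^ 2 + 32 * (s.den : ℤ) ^ 4 : ℤ) : ℚ) := by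
    push_cast
    rw [← hs]
    linear_combination (s.den : ℚ) ^ 4 * h
  obtain ⟨c, hc⟩ := Rat.exists_int_of_sq_eq_int hz
  rw [← hc] at hz
  rcases quartic_points s.isCoprime_num_den (c := c) (by exact_mod_cast hz.symm) with h1 | ⟨h1, h2⟩
  · exact absurd h1 (by exact_mod_cast s.den_nz)
  · have h1' : (s.num : ℚ) ^ 2 = 4 := by exact_mod_cast h1
    have h2' : (s.den : ℚ) ^ 2 = 1 := by exact_mod_cast h2
    rw [← hs] at h1'
    linear_combination h1' - s ^ 2 * h2'

/-- The descent map on `Y² = X (X² - 11 X + 32)`, with `X = n / d` in lowest terms. -/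
lemma Int.sq_or_two_mul_sq {n d c : ℤ} (hn : 0 < n) (hd : 0 < d) (hcop : IsCoprime n d)
    (h : n * (d * (n ^ 2 - 11 * n * d + 32 * d ^ 2)) = c ^ 2) :
    ∃ i j : ℤ, d = j ^ 2 ∧ (n = i ^ 2 ∨ n = 2 * i ^ 2) := by
  have h2 : Even 2 := even_two
  obtain ⟨j, hj⟩ : ∃ j : ℤ, d = j ^ 2 := by
    refine Int.eq_pow_of_isCoprime_of_mul_eq_pow (G := n * (n ^ 2 - 11 * n * d + 32 * d ^ 2))
      (b := c) h2 hd.le ?_ (by rw [← h]; ring)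
    refine hcop.symm.mul_right ?_
    have : IsCoprime d (n ^ 2) := hcop.symm.pow_right
    rw [show n ^ 2 - 11 * n * d + 32 * d ^ 2 = n ^ 2 + d * (32 * d - 11 * n) by ring]
    exact this.add_mul_left_right _
  obtain ⟨e, k, hk, hek⟩ := Nat.exists_eq_two_pow_mul_odd (n := n.toNat) (by lia)
  have hk' : Odd (k : ℤ) := by exact_mod_cast hk
  have hnk : n = 2 ^ e * (k : ℤ) := by
    rw [← Int.toNat_of_nonneg hn.le, hek]
    push_cast
    rfl
  obtain ⟨i, hi⟩ : ∃ i : ℤ, (k : ℤ) = i ^ 2 := by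
    refine Int.eq_pow_of_isCoprime_of_mul_eq_pow
      (G := 2 ^ e * (d * (n ^ 2 - 11 * n * d + 32 * d ^ 2)))
      (b := c) h2 (by positivity) ?_ (by linear_combination h - d * (n ^ 2 - 11 * n * d + 32 * d ^ 2) * hnk)
    have hk2 : IsCoprime (k : ℤ) 2 := (Int.isCoprime_two_of_odd hk').symm
    have hkd : IsCoprime (k : ℤ) d := by
      rw [hnk] at hcop
      exact hcop.of_mul_left_right
    refine hk2.pow_right.mul_right (hkd.mul_right ?_)
    have : IsCoprime (k : ℤ) (2 ^ 5 * d ^ 2) := hk2.pow_right.mul_right hkd.pow_right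
    rw [show n ^ 2 - 11 * n * d + 32 * d ^ 2 = 2 ^ 5 * d ^ 2 + k * (2 ^ e * (n - 11 * d)) by
      linear_combination (n - 11 * d) * hnk]
    exact this.add_mul_left_right _
  rcases Nat.even_or_odd' e with ⟨f, rfl | rfl⟩
  · exact ⟨2 ^ f * i, j, hj, Or.inl (by rw [hnk, hi]; ring)⟩
  · exact ⟨2 ^ f * i, j, hj, Or.inr (by rw [hnk, hi]; ring)⟩

/-- The abscissa of a rational point of `Y² = X (X² - 11 X + 32)` other than the origin is a square
or twice a square. -/
lemma eq_sq_or_eq_two_mul_sq {X Y : ℚ} (hX : X ≠ 0) (h : Y ^ 2 = X * (X ^ 2 - 11 * X + 32)) :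
    ∃ s : ℚ, X = s ^ 2 ∨ X = 2 * s ^ 2 := by
  have hX0 : 0 < X := by
    rcases lt_or_gt_of_ne hX with h1 | h1
    · nlinarith [sq_nonneg Y, sq_nonneg (X - 11 / 2)]
    · exact h1
  have hd : (X.den : ℚ) ≠ 0 := by exact_mod_cast X.den_nz
  have hXd : X * X.den = X.num := Rat.mul_den_eq_num X
  have hn0 : 0 < X.num := Rat.num_pos.mpr hX0
  have hcop := X.isCoprime_num_den
  have hd0 : (0 : ℤ) < X.den := by exact_mod_cast X.den_pos
  obtain ⟨c, hc⟩ : ∃ c : ℤ, c ^ 2 = X.num * (X.den *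
      (X.num ^ 2 - 11 * X.num * X.den + 32 * (X.den : ℤ) ^ 2)) := by
    have hz : (Y * (X.den : ℚ) ^ 2) ^ 2 = ((X.num * (X.den *
      (X.num ^ 2 - 11 * X.num * X.den + 32 * (X.den : ℤ) ^ 2)) : ℤ) : ℚ) := by
      push_cast
      rw [← hXd]
      linear_combination (X.den : ℚ) ^ 4 * h
    obtain ⟨c, hc⟩ := Rat.exists_int_of_sq_eq_int hz
    rw [← hc] at hz
    exact ⟨c, by exact_mod_cast hz⟩
  obtain ⟨i, j, hj, hi⟩ := Int.sq_or_two_mul_sq hn0 hd0 hcop hc.symm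
  have hj' : (X.den : ℚ) = j ^ 2 := by exact_mod_cast hj
  have hj0 : (j : ℚ) ≠ 0 := by
    rintro h0
    exact hd (by rw [hj', h0]; norm_num)
  refine ⟨i / j, hi.imp (fun hi => ?_) (fun hi => ?_)⟩ <;>
  · have hi' := congrArg (Int.cast : ℤ → ℚ) hi
    rw [← hXd, hj'] at hi'
    push_cast at hi'
    field_simp
    linarith

/-- The abscissas of the affine rational points of `Y² = X (X² - 11 X + 32)`. -/
theorem abscissa_of_curve {X Y : ℚ} (h : Y ^ 2 = X * (X ^ 2 - 11 * X + 32)) :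
    X = 0 ∨ X = 4 ∨ X = 8 := by
  by_cases hX : X = 0
  · exact Or.inl hX
  right
  obtain ⟨s, rfl | rfl⟩ := eq_sq_or_eq_two_mul_sq hX h
  · have hs : s ≠ 0 := by rintro rfl; simp at hX
    refine Or.inl (sq_eq_four_of_quartic (z := Y / s) ?_)
    rw [div_pow, h]
    field_simp
  · have hs : s ≠ 0 := by rintro rfl; simp at hX
    have : (4 / s) ^ 2 = 4 := by
      refine sq_eq_four_of_quartic (z := 2 * Y / s ^ 3) ?_
      rw [div_pow, mul_pow, h]
      field_simp
      ring
    right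
    field_simp at this
    linarith

/-- The rational points of `Y² = Z (Z² + 13 Z + 128)`, through a 3-isogeny. -/
theorem abscissa_of_isogenous_curve {Z Y : ℚ} (h : Y ^ 2 = Z * (Z ^ 2 + 13 * Z + 128)) :
    Z = 0 ∨ Z = 4 ∨ Z = 32 := by
  have hZ : 0 ≤ Z := by
    by_contra hneg
    nlinarith [sq_nonneg Y, sq_nonneg (Z + 13 / 2)]
  have h3 : 3 * Z + 16 ≠ 0 := by positivity
  have key : (Y * (Z + 24) * (Z ^ 2 - 8 * Z + 128) / (3 * Z + 16) ^ 3) ^ 2 =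
      Z * (Z + 24) ^ 2 / (3 * Z + 16) ^ 2 * ((Z * (Z + 24) ^ 2 / (3 * Z + 16) ^ 2) ^ 2 -
        11 * (Z * (Z + 24) ^ 2 / (3 * Z + 16) ^ 2) + 32) := by
    rw [div_pow, mul_pow, mul_pow, h]
    field_simp
    ring
  rcases abscissa_of_curve key with h1 | h1 | h1
  · left
    rw [div_eq_zero_iff, or_iff_left (by positivity)] at h1
    rcases mul_eq_zero.mp h1 with h2 | h2
    · exact h2
    · have : Z + 24 = 0 := by simpa using h2
      linarith
  · right; left
    field_simp at h1
    have h2 : (Z - 4) * (Z ^ 2 + 16 * Z + 256) = 0 := by linear_combination h1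
    rcases mul_eq_zero.mp h2 with h2 | h2 <;> nlinarith
  · right; right
    field_simp at h1
    have h2 : (Z - 32) * (Z ^ 2 + 8 * Z + 64) = 0 := by linear_combination h1
    rcases mul_eq_zero.mp h2 with h2 | h2 <;> nlinarith

/-- A monic integral polynomial without roots modulo `n` has no rational roots. -/
lemma Polynomial.aeval_rat_ne_zero_of_zmod {p : Polynomial ℤ} (hp : p.Monic) (n : ℕ)
    (h : ∀ x : ZMod n, aeval x p ≠ 0) (r : ℚ) : aeval r p ≠ 0 := by
  intro hr
  obtain ⟨m, rfl⟩ := isInteger_of_is_root_of_monic hp hr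
  rw [aeval_algebraMap_apply, map_eq_zero_iff _ (algebraMap ℤ ℚ).injective_int] at hr
  apply h (algebraMap ℤ (ZMod n) m)
  rw [aeval_algebraMap_apply, hr, map_zero]

open Polynomial in
/-- A monic integral quartic polynomial without roots modulo 3 has no rational roots. -/
lemma Rat.quartic_ne_zero_of_mod_three {a b c d : ℤ}
    (h : ∀ x : ZMod 3, x ^ 4 + a * x ^ 3 + b * x ^ 2 + c * x + d ≠ 0) (r : ℚ) :
    r ^ 4 + a * r ^ 3 + b * r ^ 2 + c * r + d ≠ 0 := by
  have hp : (X ^ 4 + C a * X ^ 3 + C b * X ^ 2 + C c * X + C d : ℤ[X]).Monic := by monicity!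
  simpa using aeval_rat_ne_zero_of_zmod hp 3 (by simpa using h) r

open Polynomial in
/-- A monic integral cubic polynomial without roots modulo 2 has no rational roots. -/
lemma Rat.cubic_ne_zero_of_mod_two {b c d : ℤ}
    (h : ∀ x : ZMod 2, x ^ 3 + b * x ^ 2 + c * x + d ≠ 0) (r : ℚ) :
    r ^ 3 + b * r ^ 2 + c * r + d ≠ 0 := by
  have hp : (X ^ 3 + C b * X ^ 2 + C c * X + C d : ℤ[X]).Monic := by monicity!
  simpa using aeval_rat_ne_zero_of_zmod hp 2 (by simpa using h) r

/-- The abscissas of the affine rational points of `Y² = X³ + 10 X² + 25 X + 28`. -/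
lemma abscissa_of_cubic {X Y : ℚ} (h : Y ^ 2 = X ^ 3 + 10 * X ^ 2 + 25 * X + 28) :
    X = 1 ∨ X = -7 ∨ X = -3 := by
  rcases abscissa_of_curve (X := X + 7) (Y := Y) (by linear_combination h) with h | h | h
  · exact Or.inr (Or.inl (by linarith))
  · exact Or.inr (Or.inr (by linarith))
  · exact Or.inl (by linarith)

/-- The nonzero abscissas of the affine rational points of `X Y² = X³ + 10 X² + 25 X + 28`. -/
lemma abscissa_of_twisted_cubic {X Y : ℚ} (hX : X ≠ 0)
    (h : X * Y ^ 2 = X ^ 3 + 10 * X ^ 2 + 25 * X + 28) : X = 1 ∨ X = -7 := by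
  have key : (28 * Y / X) ^ 2 = (28 / X + 4) * ((28 / X + 4) ^ 2 + 13 * (28 / X + 4) + 128) := by
    field_simp
    linear_combination 784 * h
  rcases abscissa_of_isogenous_curve key with h | h | h
  · right
    field_simp at h
    linarith
  · exfalso
    field_simp at h
    linarith
  · left
    field_simp at h
    linarith

/-- The lines meeting `Y² = X³ + 10 X² + 25 X + 28` in a third point with abscissa `1`. -/
lemma chord_one {A B lam l k y : ℚ} (hD : (B + 1) ^ 2 ≠ A ^ 2) (hB : B ≠ 0)
    (hl : l + lam = y) (hy : y ^ 2 = 64) (hB2 : B ^ 2 = l ^ 2 - 28)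
    (hA2 : A ^ 2 = 2 * B - 11 + lam ^ 2) (hk : k * A * B = lam * B - l)
    (hkk : k ^ 2 = 1 ∨ k ^ 2 * B ^ 2 = B ^ 2 + 28 ∨ k ^ 2 * B ^ 2 = B ^ 2 - 4) :
    B = 6 ∧ A ^ 2 = 1 ∧ l ^ 2 = 64 ∧ lam = 0 := by
  obtain rfl : lam = y - l := by linarith
  have hsq : k ^ 2 * B ^ 2 * A ^ 2 = ((y - l) * B - l) ^ 2 := by rw [← hk]; ring
  rcases hkk with h1 | h1 | h1
  · exfalso
    rw [h1] at hsq
    have h2 : y * l * B = 6 * B ^ 2 + 28 * B + 14 := by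
      linear_combination 1 / 2 * hsq - 1 / 2 * B ^ 2 * hA2 - (B + 1 / 2) * hB2
    have h3 : B ^ 4 + (-12 : ℤ) * B ^ 3 + (30 : ℤ) * B ^ 2 + (-28 : ℤ) * B + (-7 : ℤ) = 0 := by
      push_cast
      linear_combination 1 / 28 * (y * l * B + (6 * B ^ 2 + 28 * B + 14)) * h2
        - 1 / 28 * l ^ 2 * B ^ 2 * hy + 16 / 7 * B ^ 2 * hB2
    exact Rat.quartic_ne_zero_of_mod_three (by decide) B h3
  · rw [h1, show B ^ 2 + 28 = l ^ 2 by linarith, ← mul_pow] at hsq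
    have hl0 : l ≠ 0 := by
      rintro rfl
      nlinarith [sq_nonneg B]
    obtain ⟨a, ha, hla⟩ : ∃ a, a ^ 2 = A ^ 2 ∧ l * a = (y - l) * B - l := by
      rcases sq_eq_sq_iff_eq_or_eq_neg.mp hsq with h2 | h2
      · exact ⟨A, rfl, h2⟩
      · exact ⟨-A, by ring, by linarith⟩
    rw [← ha] at hD hA2 ⊢
    obtain ⟨p, hp⟩ : ∃ p, p = a + B + 1 := ⟨_, rfl⟩
    obtain ⟨m, hm⟩ : ∃ m, m = a - B - 1 := ⟨_, rfl⟩
    obtain rfl : B = (p - m - 2) / 2 := by linarith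
    obtain rfl : a = (p + m) / 2 := by linarith
    have hlp : l * p = y * ((p - m - 2) / 2) := by linear_combination hla
    have hp0 : p ≠ 0 := by
      rintro rfl
      exact hD (by ring)
    have hpm : p * m = 80 - 2 * y * l := by linear_combination hA2 + hy - hB2
    have h2 : (p + 8) * (m * (p - 8) - 16) = 0 := by
      linear_combination p * hpm - 2 * y * hlp - (p - m - 2) * hy
    rcases mul_eq_zero.mp h2 with h3 | h3
    · exfalso
      obtain rfl : p = -8 := by linarith
      have h4 : 64 * l ^ 2 = 64 * ((-8 - m - 2) / 2) ^ 2 := by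
        linear_combination (-8 * l + y * ((-8 - m - 2) / 2)) * hlp + ((-8 - m - 2) / 2) ^ 2 * hy
      linarith
    · have hmp : m * p = 8 * (m + 2) := by linear_combination h3
      have hmB : m * (p - m - 2) = -((m - 8) * (m + 2)) := by linear_combination h3
      have h5 : 64 * (m * (p - m - 2)) ^ 2 * m ^ 2 =
          (m * p) ^ 2 * ((m * (p - m - 2)) ^ 2 + 112 * m ^ 2) := by
        linear_combination 4 * m ^ 4 * (-(l * p + y * ((p - m - 2) / 2)) * hlp
          - ((p - m - 2) / 2) ^ 2 * hy - p ^ 2 * hB2)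
      rw [hmp, hmB] at h5
      have h6 : (m + 2) ^ 2 * ((m + 8) * (m ^ 2 + 5 * m + 8)) = 0 := by
        linear_combination -1 / 256 * h5
      rcases mul_eq_zero.mp h6 with h7 | h7
      · exfalso
        obtain rfl : m = -2 := by linarith [pow_eq_zero_iff two_ne_zero |>.mp h7]
        exact hp0 (by linarith)
      rcases mul_eq_zero.mp h7 with h8 | h8
      · obtain rfl : m = -8 := by linarith
        obtain rfl : p = 6 := by linarith
        obtain rfl : l = y := by linarith
        exact ⟨by norm_num, by norm_num, hy, by ring⟩
      · nlinarith [sq_nonneg (m + 5 / 2)]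
  · exfalso
    rw [h1] at hsq
    have h2 : y * l * (B + 4) = 8 * B ^ 2 + 32 * B + 176 := by
      linear_combination 1 / 2 * hsq - 1 / 2 * (B ^ 2 - 4) * hA2 + 2 * hy
        - 1 / 2 * (5 + 2 * B) * hB2
    have h3 : (2 * B - 3) ^ 2 = 0 := by
      linear_combination -1 / 256 * (y * l * (B + 4) + (8 * B ^ 2 + 32 * B + 176)) * h2
        + 1 / 256 * l ^ 2 * (B + 4) ^ 2 * hy - 1 / 4 * (B + 4) ^ 2 * hB2
    obtain rfl : B = 3 / 2 := by linarith [pow_eq_zero_iff two_ne_zero |>.mp h3]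
    nlinarith [sq_nonneg k]

/-- The lines meeting `Y² = X³ + 10 X² + 25 X + 28` in a third point with abscissa `-7`. -/
lemma chord_neg_seven {A B lam l k : ℚ}
    (hl : l = 7 * lam) (hB2 : 7 * B ^ 2 = 28 - l ^ 2)
    (hA2 : A ^ 2 = 2 * B - 3 + lam ^ 2) (hk : k * A * B = lam * B - l)
    (hkk : k ^ 2 = 1 ∨ k ^ 2 * B ^ 2 = B ^ 2 + 28 ∨ k ^ 2 * B ^ 2 = B ^ 2 - 4) :
    (B = 3 / 2 ∧ A ^ 2 = 1 / 4 ∧ l ^ 2 = 49 / 4 ∧ lam = l / 7) ∨ (lam = 0 ∧ l = 0) := by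
  subst hl
  have hsq : k ^ 2 * B ^ 2 * A ^ 2 = (lam * B - 7 * lam) ^ 2 := by rw [← hk]; ring
  rcases hkk with h1 | h1 | h1
  · exfalso
    rw [h1] at hsq
    have h2 : B ^ 4 + (4 : ℤ) * B ^ 3 + (-10 : ℤ) * B ^ 2 + (-28 : ℤ) * B + (49 : ℤ) = 0 := by
      have : B ^ 2 + 2 * B - 7 = 0 := by
        linear_combination 1 / 4 * hsq - 1 / 4 * B ^ 2 * hA2 + 1 / 28 * (7 - 2 * B) * hB2
      push_cast
      linear_combination (B ^ 2 + 2 * B - 7) * this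
    exact Rat.quartic_ne_zero_of_mod_three (by decide) B h2
  · left
    rw [h1] at hsq
    have h2 : 2 * B - 3 = 0 := by
      linear_combination 1 / 32 * hsq - 1 / 32 * (B ^ 2 + 28) * hA2 - 1 / 224 * (2 * B - 3) * hB2
    obtain rfl : B = 3 / 2 := by linarith
    exact ⟨rfl, by linarith, by linarith, by ring⟩
  · right
    rw [h1] at hsq
    have h2 : lam ^ 2 * (7 * A ^ 2 + (B - 7) ^ 2) = 0 := by
      linear_combination -hsq + 1 / 7 * A ^ 2 * hB2
    rcases mul_eq_zero.mp h2 with h3 | h3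
    · have : lam = 0 := by simpa using h3
      simp [this]
    · exfalso
      nlinarith [sq_nonneg A, sq_nonneg (B - 7), sq_nonneg lam]

/-- The lines meeting `Y² = X³ + 10 X² + 25 X + 28` in a third point with abscissa `-3`. -/
lemma chord_neg_three {A B lam l k y : ℚ} (hD : A ^ 2 ≠ 4 * B)
    (hl : l - 3 * lam = y) (hy : y ^ 2 = 16) (hB2 : 3 * B ^ 2 = 28 - l ^ 2)
    (hA2 : A ^ 2 = 2 * B - 7 + lam ^ 2) (hk : k * A * B = lam * B - l)
    (hkk : k ^ 2 = 1 ∨ k ^ 2 * B ^ 2 = B ^ 2 + 28 ∨ k ^ 2 * B ^ 2 = B ^ 2 - 4) :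
    B = 3 ∧ A ^ 2 = 16 / 9 ∧ l ^ 2 = 1 ∧ lam = 5 * l / 3 := by
  obtain rfl : lam = (l - y) / 3 := by linarith
  have hsq : k ^ 2 * B ^ 2 * A ^ 2 = ((l - y) / 3 * B - l) ^ 2 := by rw [← hk]; ring
  rcases hkk with h1 | h1 | h1
  · rw [h1] at hsq
    have h2 : y * l * B = -6 * B ^ 2 + 28 * B - 42 := by
      linear_combination -3 / 2 * hsq + 3 / 2 * B ^ 2 * hA2 + (B - 3 / 2) * hB2
    have h3 : (B - 1) * (B - 3) * (B ^ 2 + 7) = 0 := by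
      linear_combination -1 / 84 * (y * l * B + (-6 * B ^ 2 + 28 * B - 42)) * h2
        + 1 / 84 * l ^ 2 * B ^ 2 * hy + 4 / 21 * B ^ 2 * hB2
    have h7 : B ^ 2 + 7 ≠ 0 := by positivity
    rcases mul_eq_zero.mp ((mul_eq_zero.mp h3).resolve_right h7) with h4 | h4
    · exfalso
      obtain rfl : B = 1 := by linarith
      exact hD (by linarith)
    · obtain rfl : B = 3 := by linarith
      have hyl : y = -4 * l := by
        linear_combination 1 / 3 * l * h2 - y * hB2
      subst hyl
      have hl2 : l ^ 2 = 1 := by linarith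
      exact ⟨rfl, by linarith, hl2, by ring⟩
  · exfalso
    rw [h1] at hsq
    have h2 : y * l * (3 * B + 28) = -60 * B ^ 2 + 336 * B - 392 := by
      linear_combination -9 / 2 * hsq + 9 / 2 * (B ^ 2 + 28) * hA2 + 14 * hy
        + 1 / 2 * (19 + 6 * B) * hB2
    have h3 : B ^ 4 + (-8 : ℤ) * B ^ 3 + (48 : ℤ) * B ^ 2 + (-84 : ℤ) * B + (-49 : ℤ) = 0 := by
      push_cast
      linear_combination -1 / 4032 * (y * l * (3 * B + 28) + (-60 * B ^ 2 + 336 * B - 392)) * h2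
        + 1 / 4032 * l ^ 2 * (3 * B + 28) ^ 2 * hy + 1 / 252 * (3 * B + 28) ^ 2 * hB2
    exact Rat.quartic_ne_zero_of_mod_three (by decide) B h3
  · exfalso
    rw [h1] at hsq
    have h2 : y * l * (4 - 3 * B) = 12 * B ^ 2 - 48 * B + 88 := by
      linear_combination 9 / 2 * hsq - 9 / 2 * (B ^ 2 - 4) * hA2 + 2 * hy
        - 1 / 2 * (6 * B - 13) * hB2
    have h3 : B ^ 4 + (-4 : ℤ) * B ^ 3 + (2 : ℤ) * B ^ 2 + (4 : ℤ) * B + (1 : ℤ) = 0 := by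
      push_cast
      linear_combination -1 / 576 * (y * l * (4 - 3 * B) + (12 * B ^ 2 - 48 * B + 88)) * h2
        + 1 / 576 * l ^ 2 * (4 - 3 * B) ^ 2 * hy + 1 / 36 * (4 - 3 * B) ^ 2 * hB2
    exact Rat.quartic_ne_zero_of_mod_three (by decide) B h3

/-- The possible pairs of conjugate points on `Y² = q⁶ + 10 q⁴ + 25 q² + 28` over a quadratic field,
in terms of the lines through their images on the two elliptic quotients. -/
lemma chord_classification {A B lam l k mu x : ℚ} (hB : B ≠ 0) (hD : (B + 1) ^ 2 ≠ A ^ 2)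
    (hdisc : A ^ 2 ≠ 4 * B) (hk : k * A * B = lam * B - l)
    (hx : x = lam ^ 2 - 10 - (A ^ 2 - 2 * B))
    (h1 : B ^ 2 + x * (A ^ 2 - 2 * B) = 25 - 2 * l * lam) (h0 : x * B ^ 2 = l ^ 2 - 28)
    (g2 : (1 - k ^ 2) * B ^ 2 * (A ^ 2 - 2 * B) = 28 - (10 - 2 * k * mu) * B ^ 2)
    (g1 : (1 - k ^ 2) * B ^ 4 = 28 * (A ^ 2 - 2 * B) + (25 - mu ^ 2) * B ^ 2) :
    (B = 6 ∧ A ^ 2 = 1 ∧ l ^ 2 = 64 ∧ lam = 0) ∨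
    (B = 3 / 2 ∧ A ^ 2 = 1 / 4 ∧ l ^ 2 = 49 / 4 ∧ lam = l / 7) ∨
    (B = 3 ∧ A ^ 2 = 16 / 9 ∧ l ^ 2 = 1 ∧ lam = 5 * l / 3) ∨ (lam = 0 ∧ l = 0) := by
  have hkk : k ^ 2 = 1 ∨ k ^ 2 * B ^ 2 = B ^ 2 + 28 ∨ k ^ 2 * B ^ 2 = B ^ 2 - 4 := by
    by_cases hk1 : k ^ 2 = 1
    · exact Or.inl hk1
    right
    have hk0 : k ^ 2 - 1 ≠ 0 := sub_ne_zero.mpr hk1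
    have hr : 28 / (B ^ 2 * (k ^ 2 - 1)) ≠ 0 := by positivity
    obtain ⟨r, hr'⟩ : ∃ r, r = 28 / (B ^ 2 * (k ^ 2 - 1)) := ⟨_, rfl⟩
    rw [← hr'] at hr
    rw [eq_div_iff (by positivity)] at hr'
    have hE : r * (k * r + mu) ^ 2 = r ^ 3 + 10 * r ^ 2 + 25 * r + 28 := by
      have hB2 : B ^ 2 ≠ 0 := by positivity
      apply mul_left_cancel₀ hB2
      linear_combination r * g1 - r ^ 2 * g2 + (r ^ 2 - r * (A ^ 2 - 2 * B) + B ^ 2) * hr'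
    rcases abscissa_of_twisted_cubic hr hE with rfl | rfl
    · exact Or.inl (by linarith)
    · exact Or.inr (by linarith)
  have hE : (lam * x + l) ^ 2 = x ^ 3 + 10 * x ^ 2 + 25 * x + 28 := by
    linear_combination -x ^ 2 * hx + x * h1 - h0
  rcases abscissa_of_cubic hE with rfl | rfl | rfl
  · exact Or.inl (chord_one hD hB (y := l + lam) rfl (by linarith) (by linarith) (by linarith)
      hk hkk)
  · have hl : l = 7 * lam := by
      have : (lam * (-7) + l) ^ 2 = 0 := by rw [hE]; norm_num
      linarith [pow_eq_zero_iff two_ne_zero |>.mp this]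
    rcases chord_neg_seven hl (by linarith) (by linarith) hk hkk with h | h
    · exact Or.inr (Or.inl h)
    · exact Or.inr (Or.inr (Or.inr h))
  · exact Or.inr (Or.inr (Or.inl (chord_neg_three hdisc (y := l - 3 * lam) rfl (by linarith)
      (by linarith) (by linarith) hk hkk)))

/-- The product and the sum of the conjugates `x`, `x'`, where
`2 x (q² - 1) = q³ - 9 q + lam q² + l`. -/
lemma norm_trace_of_chord {A B lam l N n : ℚ}
    (h : (B = 6 ∧ A ^ 2 = 1 ∧ l ^ 2 = 64 ∧ lam = 0) ∨
      (B = 3 / 2 ∧ A ^ 2 = 1 / 4 ∧ l ^ 2 = 49 / 4 ∧ lam = l / 7) ∨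
      (B = 3 ∧ A ^ 2 = 16 / 9 ∧ l ^ 2 = 1 ∧ lam = 5 * l / 3))
    (hN : 4 * N * ((B + 1) ^ 2 - A ^ 2) = B ^ 3 + lam * A * B ^ 2 - 9 * B * (A ^ 2 - 2 * B)
      + l * (A ^ 3 - 3 * A * B) + lam ^ 2 * B ^ 2 - 9 * lam * A * B + l * lam * (A ^ 2 - 2 * B)
      + 81 * B - 9 * l * A + l ^ 2)
    (hn : 2 * n * ((B + 1) ^ 2 - A ^ 2) = A * B ^ 2 - (A ^ 3 - 3 * A * B)
      + lam * (2 * B ^ 2 - A ^ 2 + 2 * B) - 9 * (A * B - A) + l * (A ^ 2 - 2 * B - 2)) :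
    (N = 6 ∧ (n = 1 ∨ n = -1)) ∨ (N = 49 / 6 ∧ (n = 7 / 6 ∨ n = -7 / 6)) := by
  obtain ⟨a, b, ha, hA, hl⟩ : ∃ a b : ℚ, ((B = 6 ∧ a = 1 ∧ b = 8 ∧ lam = 0) ∨
      (B = 3 / 2 ∧ a = 1 / 2 ∧ b = 7 / 2 ∧ lam = l / 7) ∨
      (B = 3 ∧ a = 4 / 3 ∧ b = 1 ∧ lam = 5 * l / 3)) ∧ (A = a ∨ A = -a) ∧
      (l = b ∨ l = -b) := by
    simp only [← sq_eq_sq_iff_eq_or_eq_neg]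
    rcases h with ⟨hB, hA, hl, h⟩ | ⟨hB, hA, hl, h⟩ | ⟨hB, hA, hl, h⟩
    · exact ⟨1, 8, by simp [*], by linarith, by linarith⟩
    · exact ⟨1 / 2, 7 / 2, by simp [*], by linarith, by linarith⟩
    · exact ⟨4 / 3, 1, by simp [*], by linarith, by linarith⟩
  rcases ha with ⟨rfl, rfl, rfl, rfl⟩ | ⟨rfl, rfl, rfl, rfl⟩ | ⟨rfl, rfl, rfl, rfl⟩ <;>
  rcases hA with rfl | rfl <;> rcases hl with rfl | rfl <;>
  first
  | exact Or.inl ⟨by linarith, Or.inl (by linarith)⟩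
  | exact Or.inl ⟨by linarith, Or.inr (by linarith)⟩
  | exact Or.inr ⟨by linarith, Or.inl (by linarith)⟩
  | exact Or.inr ⟨by linarith, Or.inr (by linarith)⟩

/-- A field of degree at most 2 has an involution fixing exactly the rational numbers. -/
lemma exists_involution_of_finrank_le_two {K : Type*} [Field K] [NumberField K]
    (hdeg : Module.finrank ℚ K ≤ 2) :
    ∃ σ : K →+* K, (∀ z, σ (σ z) = z) ∧ ∀ z, σ z = z → ∃ r : ℚ, (r : K) = z := by
  have hpos : 0 < Module.finrank ℚ K := Module.finrank_pos
  obtain h1 | h2 : Module.finrank ℚ K = 1 ∨ Module.finrank ℚ K = 2 := by lia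
  · refine ⟨RingHom.id K, fun z => rfl, fun z _ => ?_⟩
    have : z ∈ (⊥ : Subalgebra ℚ K) := by
      rw [Subalgebra.bot_eq_top_of_finrank_eq_one h1]
      trivial
    obtain ⟨r, hr⟩ := Algebra.mem_bot.mp this
    exact ⟨r, by rw [← hr]; simp⟩
  · have : Algebra.IsQuadraticExtension ℚ K := ⟨h2⟩
    have hcard : Nat.card Gal(K/ℚ) = 2 := by rw [IsGalois.card_aut_eq_finrank, h2]
    have hall : ∃ σ : Gal(K/ℚ), ∀ τ : Gal(K/ℚ), τ = 1 ∨ τ = σ := by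
      obtain ⟨a, b, hab, h⟩ := Nat.card_eq_two_iff.mp hcard
      have h' : ∀ τ : Gal(K/ℚ), τ = a ∨ τ = b := fun τ => by
        have : τ ∈ ({a, b} : Set _) := h ▸ Set.mem_univ τ
        simpa using this
      rcases h' 1 with h1 | h1
      · exact ⟨b, fun τ => h1 ▸ h' τ⟩
      · exact ⟨a, fun τ => h1 ▸ (h' τ).symm⟩
    obtain ⟨σ, hσ⟩ := hall
    refine ⟨(σ : K →+* K), fun z => ?_, fun z hz => ?_⟩
    · have : σ ^ 2 = 1 := hcard ▸ pow_card_eq_one'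
      exact congrArg (fun τ : Gal(K/ℚ) => τ z) this
    · have : z ∈ Set.range (algebraMap ℚ K) := by
        rw [IsGalois.mem_range_algebraMap_iff_fixed]
        intro τ
        rcases hσ τ with rfl | rfl
        · rfl
        · exact hz
      obtain ⟨r, hr⟩ := this
      exact ⟨r, by rw [← hr]; simp⟩

/-- An integral cubic form without zeros modulo 2 is anisotropic over a quadratic field. -/
lemma cubic_form_anisotropic {K : Type*} [Field K] [CharZero K] {σ : K →+* K}
    (hσ : ∀ z, σ (σ z) = z) (hfix : ∀ z, σ z = z → ∃ r : ℚ, (r : K) = z)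
    {b c d : ℤ} (h : ∀ x : ZMod 2, x ^ 3 + b * x ^ 2 + c * x + d ≠ 0) {z w : K}
    (hz : z ^ 3 + b * z ^ 2 * w + c * z * w ^ 2 + d * w ^ 3 = 0) : z = 0 ∧ w = 0 := by
  have hQ : ∀ v : K, σ v = v → v ^ 3 + b * v ^ 2 + c * v + d ≠ 0 := by
    intro v hv
    obtain ⟨r, rfl⟩ := hfix v hv
    exact_mod_cast Rat.cubic_ne_zero_of_mod_two h r
  by_cases hw : w = 0
  · subst hw
    exact ⟨by simpa using hz, rfl⟩
  exfalso
  obtain ⟨v, hv⟩ : ∃ v : K, v ^ 3 + b * v ^ 2 + c * v + d = 0 := by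
    refine ⟨z / w, ?_⟩
    field_simp
    linear_combination hz
  have hv' : σ v ^ 3 + b * σ v ^ 2 + c * σ v + d = 0 := by
    simpa using congrArg σ hv
  by_cases hne : σ v = v
  · exact hQ v hne hv
  · have h2 : σ v ^ 2 + v * σ v + v ^ 2 + b * (v + σ v) + c = 0 := by
      apply mul_left_cancel₀ (sub_ne_zero.mpr hne)
      linear_combination hv' - hv
    refine hQ (-b - v - σ v) (by simp [hσ]; ring) ?_
    linear_combination hv + (-b - 2 * v - σ v) * h2

/-- The fibres of `t ↦ (t³ + t² - 2 t - 1) / (t² + t)` are orbits of an order 3 subgroup of a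
torus; this is the compatibility with the group laws. -/
lemma torus_mul {K : Type*} [Field K] {s t x y : K}
    (hs : s ^ 3 + s ^ 2 - 2 * s - 1 = x * (s ^ 2 + s))
    (ht : t ^ 3 + t ^ 2 - 2 * t - 1 = y * (t ^ 2 + t)) :
    (s * t - 1) ^ 3 + (s * t - 1) ^ 2 * (s + t + 1) - 2 * (s * t - 1) * (s + t + 1) ^ 2
        - (s + t + 1) ^ 3 = (x * y - 7) * ((s ^ 2 + s) * (t ^ 2 + t)) ∧
      (s * t - 1) * (s + t + 1) * ((s * t - 1) + (s + t + 1)) =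
        (x + y + 1) * ((s ^ 2 + s) * (t ^ 2 + t)) := by
  constructor
  · linear_combination (t ^ 3 + t ^ 2 - 2 * t - 1) * hs + x * (s ^ 2 + s) * ht
  · linear_combination (t ^ 2 + t) * hs + (s ^ 2 + s) * ht

lemma torus_of_mul_eq_seven {K : Type*} [Field K] [CharZero K] {σ : K →+* K}
    (hσ : ∀ z, σ (σ z) = z)
    (hfix : ∀ z, σ z = z → ∃ r : ℚ, (r : K) = z) {s t x y : K}
    (hs : s ^ 3 + s ^ 2 - 2 * s - 1 = x * (s ^ 2 + s))
    (ht : t ^ 3 + t ^ 2 - 2 * t - 1 = y * (t ^ 2 + t)) (hxy : x * y = 7) :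
    s ^ 2 + s + 1 = 0 ∧ t ^ 2 + t + 1 = 0 := by
  have h1 := (torus_mul hs ht).1
  rw [hxy, sub_self, zero_mul] at h1
  obtain ⟨ha, hd⟩ := cubic_form_anisotropic hσ hfix (b := 1) (c := -2) (d := -1) (by decide)
    (z := s * t - 1) (w := s + t + 1) (by push_cast; linear_combination h1)
  exact ⟨by linear_combination s * hd - ha, by linear_combination t * hd - ha⟩

lemma torus_of_mul_eq_fortynine_sixths {K : Type*} [Field K] [CharZero K] {σ : K →+* K}
    (hσ : ∀ z, σ (σ z) = z)
    (hfix : ∀ z, σ z = z → ∃ r : ℚ, (r : K) = z) {s t x y : K}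
    (hs : s ^ 3 + s ^ 2 - 2 * s - 1 = x * (s ^ 2 + s))
    (ht : t ^ 3 + t ^ 2 - 2 * t - 1 = y * (t ^ 2 + t)) (hxy : x * y = 49 / 6)
    (hadd : x + y = -7 / 6) : False := by
  obtain ⟨h1, h2⟩ := torus_mul hs ht
  rw [hxy] at h1
  rw [hadd] at h2
  obtain ⟨ha, hd⟩ := cubic_form_anisotropic hσ hfix (b := 8) (c := 5) (d := -1) (by decide)
    (z := s * t - 1) (w := s + t + 1) (by push_cast; linear_combination h1 + 7 * h2)
  have hs2 : s ^ 2 + s = -1 := by linear_combination s * hd - ha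
  have ht2 : t ^ 2 + t = -1 := by linear_combination t * hd - ha
  rw [hs2, ht2, ha, hd] at h1
  norm_num at h1

lemma torus_of_mul_eq_six {K : Type*} [Field K] [CharZero K] {σ : K →+* K}
    (hσ : ∀ z, σ (σ z) = z)
    (hfix : ∀ z, σ z = z → ∃ r : ℚ, (r : K) = z) {s t x y : K}
    (hs : s ^ 3 + s ^ 2 - 2 * s - 1 = x * (s ^ 2 + s))
    (ht : t ^ 3 + t ^ 2 - 2 * t - 1 = y * (t ^ 2 + t)) (hxy : x * y = 6)
    (hadd : x + y = -1) : False := by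
  obtain ⟨h1, h2⟩ := torus_mul hs ht
  rw [hxy] at h1
  rw [hadd, neg_add_cancel, zero_mul] at h2
  rcases mul_eq_zero.mp h2 with h3 | h3
  · rcases mul_eq_zero.mp h3 with h4 | h4
    · have h5 := cubic_form_anisotropic hσ hfix (b := 0) (c := -1) (d := -1) (by decide)
        (z := s + t + 1) (w := 1) (by
          push_cast
          linear_combination -h1 + ((s * t - 1) ^ 2 + (s * t - 1) * (s + t + 1) - 2 * (s + t + 1) ^ 2
            + (s * t - 1) + 2 + (s + t + 1)) * h4)
      exact one_ne_zero h5.2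
    · have h5 := cubic_form_anisotropic hσ hfix (b := 2) (c := 3) (d := 1) (by decide)
        (z := s ^ 2 + s) (w := 1) (by
          push_cast
          obtain rfl : t = -1 - s := by linear_combination h4
          linear_combination -h1)
      exact one_ne_zero h5.2
  · have h5 := cubic_form_anisotropic hσ hfix (b := 0) (c := -1) (d := 1) (by decide)
      (z := s + t + 1) (w := 1) (by
        push_cast
        linear_combination h1 - ((s * t - 1) ^ 2 - 2 * (s + t + 1) ^ 2 + (s * t - 1) + 2) * h3)
    exact one_ne_zero h5.2

lemma torus_cube_root_of_unity {K : Type*} [Field K] [CharZero K] {t u x : K}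
    (ht : t ^ 3 + t ^ 2 - 2 * t - 1 = x * (t ^ 2 + t))
    (hu : u ^ 3 + u ^ 2 - 2 * u - 1 = -x * (u ^ 2 + u)) (ht1 : t ^ 2 + t + 1 = 0)
    (hu1 : u ^ 2 + u + 1 = 0) : False := by
  have hx : x = 1 + 3 * t := by linear_combination ht - (t - x) * ht1
  have hx' : -x = 1 + 3 * u := by linear_combination hu - (u + x) * hu1
  have htu : t - u = 0 := by
    linear_combination 3 * ht1 - 3 * hu1 - (t - u) * (-hx - hx')
  have ht3 : 3 * t = -1 := by linear_combination (3 / 2) * htu - 1 / 2 * (hx + hx')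
  have : (7 : K) = 0 := by
    linear_combination 9 * ht1 - (3 * t + 2) * ht3
  norm_num at this

/-- The genus 2 quotient: a function `q` of a point `(t, u)`, and its relation to `x`. -/
lemma exists_quotient_point {K : Type*} [Field K] [CharZero K] {t u x : K} (hx : x ≠ 0)
    (ht : t ^ 3 + t ^ 2 - 2 * t - 1 = x * (t ^ 2 + t))
    (hu : u ^ 3 + u ^ 2 - 2 * u - 1 = -x * (u ^ 2 + u)) (ht0 : t ^ 2 + t ≠ 0)
    (hu0 : u ^ 2 + u ≠ 0) :
    ∃ q : K, q ^ 2 - 1 ≠ 0 ∧ (x ^ 2 - 7) * (q ^ 2 - 1) = x * q * (q ^ 2 - 9) := by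
  have hu' : (-1 - u) ^ 3 + (-1 - u) ^ 2 - 2 * (-1 - u) - 1 =
      (x - 1) * ((-1 - u) ^ 2 + (-1 - u)) := by linear_combination -hu
  obtain ⟨h1, h2⟩ := torus_mul ht hu'
  have htu : t - u ≠ 0 := by
    intro h
    obtain rfl : t = u := sub_eq_zero.mp h
    exact mul_ne_zero hx ht0 (by linear_combination 1 / 2 * hu - 1 / 2 * ht)
  obtain ⟨q, hq⟩ : ∃ q, q * (t - u) = 2 * (t * (-1 - u) - 1) + (t - u) :=
    ⟨_, div_mul_cancel₀ _ htu⟩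
  have h3 : (t - u) ^ 3 * (q ^ 2 - 1) = 8 * x * ((t ^ 2 + t) * (u ^ 2 + u)) := by
    linear_combination 4 * h2 +
      (t - u) * (q * (t - u) + (2 * (t * (-1 - u) - 1) + (t - u))) * hq
  have hG : (t - u) ^ 3 * (q ^ 2 - 1) ≠ 0 := by
    rw [h3]
    exact mul_ne_zero (mul_ne_zero (by norm_num) hx) (mul_ne_zero ht0 hu0)
  refine ⟨q, right_ne_zero_of_mul hG, ?_⟩
  have h4 : (t - u) ^ 3 * (q * (q ^ 2 - 9)) = 8 * (x ^ 2 - 7) * ((t ^ 2 + t) * (u ^ 2 + u)) := by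
    obtain ⟨e, he⟩ : ∃ e, e = 2 * (t * (-1 - u) - 1) + (t - u) := ⟨_, rfl⟩
    have h5 : (t - u) ^ 3 * (q * (q ^ 2 - 9)) = e ^ 3 - 9 * e * (t - u) ^ 2 := by
      rw [he, ← hq]
      ring
    rw [h5, he]
    linear_combination 8 * h1 + 4 * h2
  apply mul_left_cancel₀ (pow_ne_zero 3 htu)
  linear_combination (x ^ 2 - 7) * h3 - x * h4

/-- Two conjugate points on the genus 2 quotient, neither of whose coordinates `q ^ 2` is
rational. -/
lemma norm_trace_of_conjugate_points {K : Type*} [Field K] [CharZero K] {σ : K →+* K}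
    (hσ : ∀ z, σ (σ z) = z) (hfix : ∀ z, σ z = z → ∃ r : ℚ, (r : K) = z) {q x Y : K}
    (hq1 : q ^ 2 - 1 ≠ 0) (hne : σ q ≠ q) (hne' : σ q ≠ -q)
    (hx : 2 * x * (q ^ 2 - 1) = q ^ 3 - 9 * q + Y)
    (hY : Y ^ 2 = q ^ 6 + 10 * q ^ 4 + 25 * q ^ 2 + 28) :
    Y = 0 ∨ (x * σ x = 6 ∧ (x + σ x = 1 ∨ x + σ x = -1)) ∨
      (x * σ x = 49 / 6 ∧ (x + σ x = 7 / 6 ∨ x + σ x = -7 / 6)) := by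
  have hx' : 2 * σ x * (σ q ^ 2 - 1) = σ q ^ 3 - 9 * σ q + σ Y := by simpa [map_ofNat] using congrArg σ hx
  have hY' : σ Y ^ 2 = σ q ^ 6 + 10 * σ q ^ 4 + 25 * σ q ^ 2 + 28 := by
    simpa [map_ofNat] using congrArg σ hY
  have hq1' : σ q ^ 2 - 1 ≠ 0 := by
    simpa using (map_ne_zero σ).mpr hq1
  have hq0 : q ≠ 0 := by rintro rfl; simp at hne
  have hq0' : σ q ≠ 0 := (map_ne_zero σ).mpr hq0
  have hsub : q - σ q ≠ 0 := sub_ne_zero.mpr (Ne.symm hne)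
  have hadd : q + σ q ≠ 0 := fun h => hne' (by linear_combination h)
  have hsq : q ^ 2 - σ q ^ 2 ≠ 0 := by
    rw [sq_sub_sq]
    exact mul_ne_zero hadd hsub
  have hsq' : σ q ^ 2 - q ^ 2 ≠ 0 := by
    rw [← neg_sub]
    exact neg_ne_zero.mpr hsq
  obtain ⟨A, hA⟩ := hfix (q + σ q) (by simp [hσ, add_comm])
  obtain ⟨B, hB⟩ := hfix (q * σ q) (by simp [hσ, mul_comm])
  obtain ⟨N, hN⟩ := hfix (x * σ x) (by simp [hσ, mul_comm])
  obtain ⟨n, hn⟩ := hfix (x + σ x) (by simp [hσ, add_comm])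
  obtain ⟨lam, hlam⟩ := hfix ((Y - σ Y) / (q ^ 2 - σ q ^ 2)) (by
    simp only [map_div₀, map_sub, map_pow, hσ]
    field_simp
    ring)
  obtain ⟨k, hk⟩ := hfix ((Y / q - σ Y / σ q) / (q ^ 2 - σ q ^ 2)) (by
    simp only [map_div₀, map_sub, map_pow, hσ]
    field_simp
    ring)
  rw [eq_div_iff hsq] at hlam hk
  obtain ⟨l, hl⟩ := hfix (Y - lam * q ^ 2) (by
    simp only [map_sub, map_mul, map_pow, map_ratCast]
    linear_combination hlam)
  obtain ⟨mu, hmu⟩ := hfix (Y / q - k * q ^ 2) (by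
    simp only [map_div₀, map_sub, map_mul, map_pow, map_ratCast]
    linear_combination hk)
  have e1 : Y = lam * q ^ 2 + l := by linear_combination -hl
  have e1' : σ Y = lam * σ q ^ 2 + l := by linear_combination -hl + hlam
  have e2 : Y = q * (k * q ^ 2 + mu) := by
    rw [hmu]
    field_simp
    ring
  have e2' : σ Y = σ q * (k * σ q ^ 2 + mu) := by
    have : (k * σ q ^ 2 + mu : K) = σ Y / σ q := by linear_combination hmu - hk
    rw [this]
    field_simp
  generalize σ q = p at *
  generalize σ Y = Z at *
  generalize σ x = w at *
  have hk' : k * A * B = lam * B - l := by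
    have : (k * A * B : K) = lam * B - l := by
      apply mul_left_cancel₀ hsub
      rw [hA, hB]
      linear_combination p * (e1 - e2) - q * (e1' - e2')
    exact_mod_cast this
  rw [e1] at hY
  rw [e1'] at hY'
  have c1 : (lam ^ 2 - 10 - (A ^ 2 - 2 * B)) * B ^ 2 = l ^ 2 - 28 := by
    have : ((lam ^ 2 - 10 - (A ^ 2 - 2 * B)) * B ^ 2 : K) = l ^ 2 - 28 := by
      apply mul_left_cancel₀ hsq
      rw [hA, hB]
      linear_combination p ^ 2 * hY - q ^ 2 * hY'
    exact_mod_cast this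
  have c2 : B ^ 2 + (lam ^ 2 - 10 - (A ^ 2 - 2 * B)) * (A ^ 2 - 2 * B) = 25 - 2 * l * lam := by
    have : (B ^ 2 + (lam ^ 2 - 10 - (A ^ 2 - 2 * B)) * (A ^ 2 - 2 * B) : K) =
        25 - 2 * l * lam := by
      apply mul_left_cancel₀ hsq
      rw [hA, hB]
      linear_combination hY - hY'
    exact_mod_cast this
  rw [← e1, e2] at hY
  rw [← e1', e2'] at hY'
  have c3 : (1 - k ^ 2) * B ^ 2 * (A ^ 2 - 2 * B) = 28 - (10 - 2 * k * mu) * B ^ 2 := by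
    have : ((1 - k ^ 2) * B ^ 2 * (A ^ 2 - 2 * B) : K) = 28 - (10 - 2 * k * mu) * B ^ 2 := by
      apply mul_left_cancel₀ hsq
      rw [hA, hB]
      linear_combination -p ^ 2 * hY + q ^ 2 * hY'
    exact_mod_cast this
  have c4 : (1 - k ^ 2) * B ^ 4 = 28 * (A ^ 2 - 2 * B) + (25 - mu ^ 2) * B ^ 2 := by
    have : ((1 - k ^ 2) * B ^ 4 : K) = 28 * (A ^ 2 - 2 * B) + (25 - mu ^ 2) * B ^ 2 := by
      apply mul_left_cancel₀ hsq
      rw [hA, hB]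
      linear_combination q ^ 4 * hY' - p ^ 4 * hY
    exact_mod_cast this
  have hB0 : B ≠ 0 := by
    rintro rfl
    exact mul_ne_zero hq0 hq0' (by rw [← hB]; simp)
  have hD : (B + 1) ^ 2 ≠ A ^ 2 := by
    intro h
    have : ((B + 1) ^ 2 : K) = A ^ 2 := by exact_mod_cast h
    rw [hA, hB] at this
    exact mul_ne_zero hq1 hq1' (by linear_combination this)
  have hdisc : A ^ 2 ≠ 4 * B := by
    intro h
    have : (A ^ 2 : K) = 4 * B := by exact_mod_cast h
    rw [hA, hB] at this
    exact pow_ne_zero 2 hsub (by linear_combination this)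
  have hclass := chord_classification hB0 hD hdisc hk' rfl c2 c1 c3 c4
  rw [← or_assoc, ← or_assoc, or_assoc (a := _ ∧ _)] at hclass
  rcases hclass with hclass | ⟨h1, h2⟩
  · right
    have hN' : 4 * N * ((B + 1) ^ 2 - A ^ 2) = B ^ 3 + lam * A * B ^ 2 - 9 * B * (A ^ 2 - 2 * B)
      + l * (A ^ 3 - 3 * A * B) + lam ^ 2 * B ^ 2 - 9 * lam * A * B + l * lam * (A ^ 2 - 2 * B)
      + 81 * B - 9 * l * A + l ^ 2 := by
      have : (4 * N * ((B + 1) ^ 2 - A ^ 2) : K) = B ^ 3 + lam * A * B ^ 2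
        - 9 * B * (A ^ 2 - 2 * B) + l * (A ^ 3 - 3 * A * B) + lam ^ 2 * B ^ 2 - 9 * lam * A * B
        + l * lam * (A ^ 2 - 2 * B) + 81 * B - 9 * l * A + l ^ 2 := by
        rw [hA, hB, hN]
        rw [e1] at hx
        rw [e1'] at hx'
        linear_combination 2 * w * (p ^ 2 - 1) * hx + (q ^ 3 - 9 * q + (lam * q ^ 2 + l)) * hx'
      exact_mod_cast this
    have hn' : 2 * n * ((B + 1) ^ 2 - A ^ 2) = A * B ^ 2 - (A ^ 3 - 3 * A * B)
      + lam * (2 * B ^ 2 - A ^ 2 + 2 * B) - 9 * (A * B - A) + l * (A ^ 2 - 2 * B - 2) := by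
      have : (2 * n * ((B + 1) ^ 2 - A ^ 2) : K) = A * B ^ 2 - (A ^ 3 - 3 * A * B)
        + lam * (2 * B ^ 2 - A ^ 2 + 2 * B) - 9 * (A * B - A) + l * (A ^ 2 - 2 * B - 2) := by
        rw [hA, hB, hn]
        rw [e1] at hx
        rw [e1'] at hx'
        linear_combination (p ^ 2 - 1) * hx + (q ^ 2 - 1) * hx'
      exact_mod_cast this
    rw [← hN, ← hn]
    rcases norm_trace_of_chord hclass hN' hn' with ⟨rfl, rfl | rfl⟩ | ⟨rfl, rfl | rfl⟩ <;> norm_num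
  · left
    simp [e1, h1, h2]

/-- The curve `f(t) g(u) + f(u) g(t) = 0`, with `f = T³ + T² - 2 T - 1` and `g = T² + T`, has no
quadratic points outside the zeros of `g`. -/
theorem no_points_of_involution {K : Type*} [Field K] [CharZero K] {σ : K →+* K}
    (hσ : ∀ z, σ (σ z) = z) (hfix : ∀ z, σ z = z → ∃ r : ℚ, (r : K) = z) {t u x : K}
    (ht : t ^ 3 + t ^ 2 - 2 * t - 1 = x * (t ^ 2 + t))
    (hu : u ^ 3 + u ^ 2 - 2 * u - 1 = -x * (u ^ 2 + u)) (ht0 : t ^ 2 + t ≠ 0)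
    (hu0 : u ^ 2 + u ≠ 0) : False := by
  have hx : x ≠ 0 := by
    rintro rfl
    exact one_ne_zero (cubic_form_anisotropic hσ hfix (b := 1) (c := -2) (d := -1) (by decide)
      (z := t) (w := 1) (by push_cast; linear_combination ht)).2
  have ht' : σ t ^ 3 + σ t ^ 2 - 2 * σ t - 1 = σ x * (σ t ^ 2 + σ t) := by
    simpa [map_ofNat] using congrArg σ ht
  have hu' : σ u ^ 3 + σ u ^ 2 - 2 * σ u - 1 = -σ x * (σ u ^ 2 + σ u) := by
    simpa [map_ofNat] using congrArg σ hu
  have key : x ^ 2 ≠ -7 := by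
    intro h
    obtain ⟨h1, h2⟩ := torus_of_mul_eq_seven hσ hfix ht hu (by linear_combination -h)
    exact torus_cube_root_of_unity ht hu h1 h2
  obtain ⟨q, hq1, hq⟩ := exists_quotient_point hx ht hu ht0 hu0
  obtain ⟨Y, hY⟩ : ∃ Y, 2 * x * (q ^ 2 - 1) = q ^ 3 - 9 * q + Y :=
    ⟨2 * x * (q ^ 2 - 1) - (q ^ 3 - 9 * q), by ring⟩
  have hY2 : Y ^ 2 = q ^ 6 + 10 * q ^ 4 + 25 * q ^ 2 + 28 := by
    obtain rfl : Y = 2 * x * (q ^ 2 - 1) - (q ^ 3 - 9 * q) := by linear_combination -hY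
    linear_combination 4 * (q ^ 2 - 1) * hq
  have hY0 : Y ≠ 0 := by
    rintro rfl
    apply key
    apply mul_left_cancel₀ hq1
    linear_combination -hq + x * hY
  have hq' : (σ x ^ 2 - 7) * (σ q ^ 2 - 1) = σ x * σ q * (σ q ^ 2 - 9) := by
    simpa [map_ofNat] using congrArg σ hq
  have hY' : 2 * σ x * (σ q ^ 2 - 1) = σ q ^ 3 - 9 * σ q + σ Y := by simpa [map_ofNat] using congrArg σ hY
  by_cases hc : σ q = q
  · rw [hc] at hq' hY'
    have h1 : (x - σ x) * (x * σ x + 7) = 0 := by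
      apply mul_left_cancel₀ hq1
      linear_combination σ x * hq - x * hq'
    rcases mul_eq_zero.mp h1 with h2 | h2
    · obtain ⟨r, rfl⟩ := hfix q hc
      obtain ⟨s, rfl⟩ := hfix Y (by linear_combination hY - hY' - 2 * ((r : K) ^ 2 - 1) * h2)
      have hE : s ^ 2 = (r ^ 2) ^ 3 + 10 * (r ^ 2) ^ 2 + 25 * r ^ 2 + 28 := by
        have : s ^ 2 = r ^ 6 + 10 * r ^ 4 + 25 * r ^ 2 + 28 := by exact_mod_cast hY2
        linear_combination this
      rcases abscissa_of_cubic hE with h3 | h3 | h3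
      · exact hq1 (by rw [sub_eq_zero]; exact_mod_cast h3)
      · nlinarith
      · nlinarith
    · obtain ⟨h3, h4⟩ := torus_of_mul_eq_seven hσ hfix hu ht' (by linear_combination -h2)
      refine torus_cube_root_of_unity ht hu (σ.injective ?_) h3
      simpa using h4
  by_cases hc' : σ q = -q
  · rw [hc'] at hq' hY'
    have h1 : (x + σ x) * (x * σ x - 7) = 0 := by
      apply mul_left_cancel₀ hq1
      linear_combination σ x * hq + x * hq'
    rcases mul_eq_zero.mp h1 with h2 | h2
    · have hq0 : q ≠ 0 := by
        rintro rfl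
        simp at hc
      obtain ⟨r, hr⟩ := hfix (q ^ 2) (by rw [map_pow, hc']; ring)
      obtain ⟨s, hs⟩ := hfix (Y / q) (by
        rw [map_div₀, hc', div_neg, ← neg_div]
        congr 1
        linear_combination hY + hY' - 2 * (q ^ 2 - 1) * h2)
      rw [eq_div_iff hq0] at hs
      have hr0 : r ≠ 0 := by
        rintro rfl
        exact pow_ne_zero 2 hq0 (by rw [← hr]; simp)
      have hE : r * s ^ 2 = r ^ 3 + 10 * r ^ 2 + 25 * r + 28 := by
        have : (r * s ^ 2 : K) = r ^ 3 + 10 * r ^ 2 + 25 * r + 28 := by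
          rw [hr]
          rw [← hs] at hY2
          linear_combination hY2
        exact_mod_cast this
      rcases abscissa_of_twisted_cubic hr0 hE with rfl | rfl
      · exact hq1 (by rw [← hr]; simp)
      · apply pow_ne_zero 2 hY0
        push_cast at hr
        rw [hY2]
        linear_combination -(q ^ 4 + 3 * q ^ 2 + 4) * hr
    · have hxx : x * σ x = 7 := by linear_combination h2
      exact torus_cube_root_of_unity ht hu (torus_of_mul_eq_seven hσ hfix ht ht' hxx).1
        (torus_of_mul_eq_seven hσ hfix hu hu' (by linear_combination hxx)).1
  rcases norm_trace_of_conjugate_points hσ hfix hq1 hc hc' hY hY2 with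
    h | ⟨h1, h2 | h2⟩ | ⟨h1, h2 | h2⟩
  · exact hY0 h
  · exact torus_of_mul_eq_six hσ hfix hu hu' (by linear_combination h1) (by linear_combination -h2)
  · exact torus_of_mul_eq_six hσ hfix ht ht' h1 h2
  · exact torus_of_mul_eq_fortynine_sixths hσ hfix hu hu' (by linear_combination h1)
      (by linear_combination -h2)
  · exact torus_of_mul_eq_fortynine_sixths hσ hfix ht ht' h1 h2

theorem curve_3and3_points {K : Type*} [Field K] [NumberField K]
    (hdeg : Module.finrank ℚ K ≤ 2) :
    {p : K × K |
        p.1 * (p.1 + 1) * p.2 ^ 3 + (p.1 ^ 3 + 2 * p.1 ^ 2 - p.1 - 1) * p.2 ^ 2 +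
          (p.1 ^ 3 - p.1 ^ 2 - 4 * p.1 - 1) * p.2 - p.1 * (p.1 + 1) = 0} =
      {((0 : K), (-1 : K)), (0, 0), (-1, 0), (-1, -1)} := by
  ext ⟨t, u⟩
  simp only [Set.mem_ofPred_eq, Set.mem_insert_iff, Set.mem_singleton_iff, Prod.mk.injEq]
  constructor
  · intro h
    have h' : (t ^ 3 + t ^ 2 - 2 * t - 1) * (u ^ 2 + u) +
        (u ^ 3 + u ^ 2 - 2 * u - 1) * (t ^ 2 + t) = 0 := by linear_combination h
    have hg : ∀ z : K, z ^ 2 + z = 0 → z = 0 ∨ z = -1 := fun z hz => by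
      rw [← add_eq_zero_iff_eq_neg, ← mul_eq_zero]
      linear_combination hz
    have hf : ∀ z : K, z ^ 2 + z = 0 → z ^ 3 + z ^ 2 - 2 * z - 1 ≠ 0 := fun z hz => by
      rcases hg z hz with rfl | rfl <;> norm_num
    by_cases ht0 : t ^ 2 + t = 0
    · have hu0 : u ^ 2 + u = 0 := by
        simpa [ht0, hf t ht0] using h'
      rcases hg t ht0 with rfl | rfl <;> rcases hg u hu0 with rfl | rfl <;> simp
    exfalso
    have hu0 : u ^ 2 + u ≠ 0 := fun hu0 => by
      simp [hu0, hf u hu0, ht0] at h'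
    obtain ⟨σ, hσ, hfix⟩ := exists_involution_of_finrank_le_two hdeg
    have ht := (div_mul_cancel₀ (t ^ 3 + t ^ 2 - 2 * t - 1) ht0).symm
    refine no_points_of_involution hσ hfix ht ?_ ht0 hu0
    apply mul_left_cancel₀ ht0
    linear_combination h' - (u ^ 2 + u) * ht
  · rintro (⟨rfl, rfl⟩ | ⟨rfl, rfl⟩ | ⟨rfl, rfl⟩ | ⟨rfl, rfl⟩) <;> ring
end
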